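/- arXiv:1501.07395 — 3 statements merged into one kernel-verified Lean document; each statement's English description precedes it below -/
import Mathlib

section
/- Let (B,n) be a two-dimensional Cohen–Macaulay Noetherian local ring with minimal multiplicity, and let (A,m) be a one-dimensional Cohen–Macaulay Noetherian local ring which is a quotient of B (i.e., A ≅ B/I for some ideal I of B). If M is a maximal Cohen–Macaulay A-module, then the Hilbert function of M with respect to m is non-decreasing: H(M,n) ≤ H(M,n+1) for all n ≥ 0. -/
open IsLocalRing

/-- The length of a module, i.e. the Krull dimension of its lattice of submodules. -/
noncomputable def moduleLength (R : Type*) (M : Type*) [CommRing R] [AddCommGroup M]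
    [Module R M] : WithBot ℕ∞ :=
  Order.krullDim (Submodule R M)

/-- The Hilbert function of a module `M` with respect to an ideal `I`:
`n ↦ length (I^n M / I^(n+1) M)`. -/
noncomputable def hilbertFn (R : Type*) (M : Type*) [CommRing R] [AddCommGroup M]
    [Module R M] (I : Ideal R) (n : ℕ) : WithBot ℕ∞ :=
  moduleLength R (↥(I ^ n • (⊤ : Submodule R M)) ⧸
    (Submodule.comap (I ^ n • (⊤ : Submodule R M)).subtype (I ^ (n + 1) • (⊤ : Submodule R M))))

/-- The depth of `M` with respect to the ideal `I`: the supremum of lengths of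
`M`-regular sequences consisting of elements of `I`. -/
noncomputable def seqDepth (R : Type*) (M : Type*) [CommRing R] [AddCommGroup M]
    [Module R M] (I : Ideal R) : ℕ∞ :=
  sSup {n : ℕ∞ | ∃ rs : List R, (rs.length : ℕ∞) = n ∧ (∀ x ∈ rs, x ∈ I) ∧
    RingTheory.Sequence.IsRegular M rs}

/-- A `d`-dimensional Cohen–Macaulay local ring has minimal multiplicity if there is a
system of parameters `x₁, …, x_d` with `𝔫² = (x₁, …, x_d)·𝔫`. -/
def HasMinimalMultiplicity (R : Type*) [CommRing R] [IsLocalRing R] (d : ℕ) : Prop :=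
  ∃ x : Fin d → R, (∀ i, x i ∈ maximalIdeal R) ∧
    (maximalIdeal R) ^ 2 = Ideal.span (Set.range x) * maximalIdeal R

namespace Submodule

section RelativeLength

variable {A M : Type*} [CommRing A] [AddCommGroup M] [Module A M]

/-- Length is additive along a chain `K ≤ P ≤ N` of submodules. -/
theorem length_quotient_submoduleOf_add {K P N : Submodule A M} (hKP : K ≤ P) (hPN : P ≤ N) :
    Module.length A (N ⧸ K.submoduleOf N) =
      Module.length A (P ⧸ K.submoduleOf P) + Module.length A (N ⧸ P.submoduleOf N) := by
  refine Module.length_eq_add_of_exact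
    (mapQ (K.submoduleOf P) (K.submoduleOf N) (inclusion hPN) fun _ h ↦ h)
    (mapQ (K.submoduleOf N) (P.submoduleOf N) LinearMap.id fun _ h ↦ hKP h) ?_ ?_ ?_
  · refine (injective_iff_map_eq_zero _).mpr ?_
    rintro ⟨z⟩ hz
    exact (Quotient.mk_eq_zero (K.submoduleOf P)).mpr
      ((Quotient.mk_eq_zero (K.submoduleOf N)).mp hz)
  · rintro ⟨z⟩
    exact ⟨Quotient.mk z, rfl⟩
  · rintro ⟨z⟩
    constructor
    · intro h
      have hz : (z : M) ∈ P := (Quotient.mk_eq_zero (P.submoduleOf N)).mp h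
      exact ⟨Quotient.mk ⟨z, hz⟩, rfl⟩
    · rintro ⟨⟨w⟩, hw⟩
      rw [← hw]
      exact (Quotient.mk_eq_zero (P.submoduleOf N)).mpr w.2

/-- An injective linear map preserves relative lengths. -/
theorem length_map_quotient_submoduleOf {f : M →ₗ[A] M} (hf : Function.Injective f)
    (P N : Submodule A M) :
    Module.length A (N.map f ⧸ (P.map f).submoduleOf (N.map f)) =
      Module.length A (N ⧸ P.submoduleOf N) := by
  refine (LinearEquiv.length_eq
    (Submodule.Quotient.equiv (P.submoduleOf N) _ (equivMapOfInjective f hf N) ?_)).symm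
  ext ⟨z, hz⟩
  obtain ⟨w, hw, rfl⟩ := hz
  constructor
  · rintro ⟨v, hv, hvz⟩
    exact ⟨v, hv, congrArg Subtype.val hvz⟩
  · rintro ⟨v, hv, hvw⟩
    obtain rfl := hf hvw
    exact ⟨⟨v, hw⟩, hv, rfl⟩

/-- If `L = f N + g N`, with `f` and `g` commuting and `g P ≤ N`, then `g` induces a surjection
`N / f P → L / f N`. -/
theorem length_quotient_map_le {f g : M →ₗ[A] M} (hfg : Commute f g) {P N L : Submodule A M}
    (hL : L = N.map f ⊔ N.map g) (hgP : P.map g ≤ N) :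
    Module.length A (L ⧸ (N.map f).submoduleOf L) ≤
      Module.length A (N ⧸ (P.map f).submoduleOf N) := by
  have hgN : ∀ z ∈ N, g z ∈ L := fun z hz ↦ hL ▸ mem_sup_right (mem_map_of_mem hz)
  refine Module.length_le_of_surjective
    (mapQ ((P.map f).submoduleOf N) ((N.map f).submoduleOf L) (g.restrict hgN) ?_) ?_
  · rintro z ⟨w, hw, hwz⟩
    refine ⟨g w, hgP (mem_map_of_mem hw), ?_⟩
    have h : f (g w) = g (f w) := LinearMap.congr_fun hfg.eq w
    rw [h, hwz]
    rfl
  · rintro ⟨⟨z, hz⟩⟩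
    have hz' := hz
    rw [hL] at hz'
    obtain ⟨_, ⟨u, hu, rfl⟩, _, ⟨v, hv, rfl⟩, huv⟩ := mem_sup.mp hz'
    refine ⟨Quotient.mk ⟨v, hv⟩, (Submodule.Quotient.eq _).mpr ?_⟩
    refine ⟨-u, N.neg_mem hu, ?_⟩
    change f (-u) = g v - z
    rw [← huv, map_neg]
    abel

/-- Consecutive relative lengths grow along `N ≥ P ≥ L` if `L = x P + y P`, where `x` is regular
and `P / x N` has finite length. -/
theorem length_quotient_le_of_eq_map_sup_map {f g : M →ₗ[A] M} (hf : Function.Injective f)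
    (hfg : Commute f g) {N P L : Submodule A M} (hPN : P ≤ N) (hLP : L ≤ P)
    (hfN : N.map f ≤ P) (hgN : N.map g ≤ P) (hL : L = P.map f ⊔ P.map g)
    (hfin : Module.length A (P ⧸ (N.map f).submoduleOf P) ≠ ⊤) :
    Module.length A (N ⧸ P.submoduleOf N) ≤ Module.length A (P ⧸ L.submoduleOf P) := by
  have h₁ := length_quotient_submoduleOf_add (map_mono (f := f) hPN) hfN
  have h₂ := length_quotient_submoduleOf_add (K := P.map f) (hL ▸ le_sup_left) hLP
  rw [length_map_quotient_submoduleOf hf] at h₁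
  have h₃ := length_quotient_map_le hfg hL hgN
  rw [← ENat.add_le_add_iff_right hfin, ← h₁, h₂, add_comm]
  gcongr

end RelativeLength

end Submodule

/-- A finite module annihilated by `x` has finite length if `R ⧸ (x)` is Artinian. -/
theorem Module.length_ne_top_of_smul_eq_zero {R M : Type*} [CommRing R] [AddCommGroup M]
    [Module R M] [Module.Finite R M] (x : R) [IsArtinianRing (R ⧸ Ideal.span {x})]
    (hx : ∀ z : M, x • z = 0) : Module.length R M ≠ ⊤ := by
  have htors : Module.IsTorsionBySet R M (Ideal.span {x} : Ideal R) := by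
    exact (Module.isTorsionBySet_span_singleton_iff x).mpr hx
  let : Module (R ⧸ Ideal.span {x}) M := htors.module
  have : IsScalarTower R (R ⧸ Ideal.span {x}) M := htors.isScalarTower
  have : Module.Finite (R ⧸ Ideal.span {x}) M := .of_restrictScalars_finite R _ M
  have : IsNoetherian (R ⧸ Ideal.span {x}) M := inferInstance
  rw [Module.length_eq_of_surjective (S := R) (R := R ⧸ Ideal.span {x})
    Ideal.Quotient.mk_surjective]
  exact Module.length_ne_top

/-- If no minimal prime contains both `x` and `y`, then some `x + b * y` avoids all the minimal
primes. -/
theorem Ideal.exists_add_mul_notMem_minimalPrimes {R : Type*} [CommRing R] [IsNoetherianRing R]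
    {x y : R} (h : ∀ P ∈ minimalPrimes R, x ∈ P → y ∉ P) :
    ∃ b : R, ∀ P ∈ minimalPrimes R, x + b * y ∉ P := by
  have hfin := minimalPrimes.finite_of_isNoetherianRing R
  have hT : {P ∈ minimalPrimes R | x ∉ P}.Finite := hfin.subset (Set.sep_subset _ _)
  have hS : {P ∈ minimalPrimes R | x ∈ P}.Finite := hfin.subset (Set.sep_subset _ _)
  have hnot : ¬ ((hT.toFinset.inf id : Ideal R) : Set R) ⊆
      ⋃ P ∈ {P ∈ minimalPrimes R | x ∈ P}, (id P : Ideal R) := by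
    intro hsub
    obtain ⟨P, ⟨hP, hxP⟩, hle⟩ := (Ideal.subset_union_prime_finite hS (f := id) ⊥ ⊥
      fun P hP _ _ ↦ hP.1.1.1).mp hsub
    obtain ⟨Q, hQ, hQP⟩ := (Ideal.IsPrime.inf_le' hP.1.1).mp hle
    obtain ⟨hQ, hxQ⟩ := hT.mem_toFinset.mp hQ
    exact hxQ (hP.2 hQ.1 hQP hxP)
  obtain ⟨b, hbT, hbS⟩ := Set.not_subset.mp hnot
  refine ⟨b, fun P hP hmem ↦ ?_⟩
  by_cases hx : x ∈ P
  · rcases hP.1.1.mem_or_mem ((P.add_mem_iff_right hx).mp hmem) with hb | hy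
    · exact hbS (Set.mem_biUnion (show P ∈ {P ∈ minimalPrimes R | x ∈ P} from ⟨hP, hx⟩) hb)
    · exact h P hP hx hy
  · have hb : b ∈ P := (Finset.inf_le (f := id) (hT.mem_toFinset.mpr ⟨hP, hx⟩) :
      hT.toFinset.inf id ≤ P) hbT
    exact hx ((P.add_mem_iff_left (P.mul_mem_right y hb)).mp hmem)

/-- A module of positive depth admits a regular element in the ideal. -/
theorem exists_isSMulRegular_of_seqDepth_ne_zero {R M : Type*} [CommRing R] [AddCommGroup M]
    [Module R M] {I : Ideal R} (h : seqDepth R M I ≠ 0) : ∃ r ∈ I, IsSMulRegular M r := by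
  contrapose! h
  rw [seqDepth, ← nonpos_iff_eq_zero, sSup_le_iff]
  rintro _ ⟨rs, rfl, hmem, hreg⟩
  cases rs with
  | nil => simp
  | cons r rs =>
    exact absurd ((RingTheory.Sequence.isRegular_cons_iff M r rs).mp hreg).1
      (h r (hmem r (by simp)))

section OneDimensional

variable {A : Type*} [CommRing A] [IsLocalRing A]

theorem maximalIdeal_notMem_minimalPrimes_of_ringKrullDim_eq_one (hdim : ringKrullDim A = 1) :
    maximalIdeal A ∉ minimalPrimes A := by
  intro h
  have : Ring.KrullDimLE 0 A := .mk₀ fun P hP ↦ by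
    rw [le_antisymm (le_maximalIdeal hP.ne_top)
      (h.2 ⟨hP, bot_le⟩ (le_maximalIdeal hP.ne_top))]
    infer_instance
  rw [ringKrullDimZero_iff_ringKrullDim_eq_zero, hdim] at this
  exact one_ne_zero this

theorem mem_minimalPrimes_of_ringKrullDim_eq_one (hdim : ringKrullDim A = 1) {P : Ideal A}
    (hP : P.IsPrime) (hne : P ≠ maximalIdeal A) : P ∈ minimalPrimes A := by
  have : Ring.KrullDimLE 1 A := (Order.krullDimLE_iff 1 _).mpr hdim.le
  exact (Ring.krullDimLE_one_iff.mp this P hP).resolve_right fun h ↦ hne (eq_maximalIdeal h)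

theorem isArtinianRing_quotient_span_singleton_of_notMem_minimalPrimes [IsNoetherianRing A]
    (hdim : ringKrullDim A = 1) {x : A} (hx : ∀ P ∈ minimalPrimes A, x ∉ P) :
    IsArtinianRing (A ⧸ Ideal.span {x}) := by
  rw [isArtinianRing_iff_krullDimLE_zero,
    Ideal.krullDimLE_zero_quotient_iff_forall_minimalPrimes_isMaximal]
  intro P hP
  by_cases hne : P = maximalIdeal A
  · rw [hne]
    infer_instance
  · exact absurd (hP.1.2 (Ideal.mem_span_singleton_self x))
      (hx P (mem_minimalPrimes_of_ringKrullDim_eq_one hdim hP.1.1 hne))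

theorem isSMulRegular_of_notMem_minimalPrimes [IsNoetherianRing A]
    (hdim : ringKrullDim A = 1) {M : Type*} [AddCommGroup M] [Module A M]
    (hM : ∃ r ∈ maximalIdeal A, IsSMulRegular M r) {x : A} (hx : ∀ P ∈ minimalPrimes A, x ∉ P) :
    IsSMulRegular M x := by
  by_contra hreg
  have hunion := biUnion_associatedPrimes_eq_compl_regular A M
  obtain ⟨P, hP, hxP⟩ := Set.mem_iUnion₂.mp (hunion.symm ▸ hreg : x ∈ ⋃ p ∈ associatedPrimes A M, p)
  refine hx P (mem_minimalPrimes_of_ringKrullDim_eq_one hdim hP.1 ?_) hxP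
  rintro rfl
  obtain ⟨r, hr, hrM⟩ := hM
  have hr' : r ∈ ⋃ p ∈ associatedPrimes A M, (p : Set A) := Set.mem_biUnion hP hr
  rw [hunion] at hr'
  exact hr' hrM

end OneDimensional

/-- The equality `𝔫² = (x, y) 𝔫` descends to quotients. -/
theorem HasMinimalMultiplicity.exists_sq_maximalIdeal_eq_of_surjective {B A : Type*} [CommRing B]
    [IsLocalRing B] [CommRing A] [IsLocalRing A] (h : HasMinimalMultiplicity B 2) (π : B →+* A)
    (hπ : Function.Surjective π) :
    ∃ x ∈ maximalIdeal A, ∃ y ∈ maximalIdeal A,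
      maximalIdeal A ^ 2 = Ideal.span {x, y} * maximalIdeal A := by
  obtain ⟨x, hx, hsq⟩ := h
  have hmap := map_maximalIdeal_of_surjective π hπ
  refine ⟨π (x 0), hmap ▸ Ideal.mem_map_of_mem π (hx 0),
    π (x 1), hmap ▸ Ideal.mem_map_of_mem π (hx 1), ?_⟩
  have h₂ := congrArg (Ideal.map π) hsq
  rw [Ideal.map_pow, Ideal.map_mul, hmap, Ideal.map_span, ← Set.range_comp] at h₂
  rw [h₂]
  congr 2
  ext z
  simp [Fin.exists_fin_two, eq_comm]

/-- If `(B,𝔫)` is a two-dimensional Cohen–Macaulay Noetherian local ring with minimal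
multiplicity and `(A,𝔪)` is a one-dimensional Cohen–Macaulay Noetherian local ring which is
a quotient of `B`, then the Hilbert function of any maximal Cohen–Macaulay `A`-module `M`
is non-decreasing. -/
theorem hilbert_monotone_of_quotient_of_minimal_multiplicity
    (B : Type*) [CommRing B] [IsNoetherianRing B] [IsLocalRing B]
    (hdimB : ringKrullDim B = 2)
    (hdepthB : seqDepth B B (maximalIdeal B) = 2)
    (hminmult : HasMinimalMultiplicity B 2)
    (A : Type*) [CommRing A] [IsNoetherianRing A] [IsLocalRing A]
    (hdimA : ringKrullDim A = 1)
    (hdepthA : seqDepth A A (maximalIdeal A) = 1)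
    (hquot : ∃ π : B →+* A, Function.Surjective π)
    (M : Type*) [AddCommGroup M] [Module A M] [Module.Finite A M]
    (hM0 : Nontrivial M)
    (hMCM : seqDepth A M (maximalIdeal A) = 1) :
    ∀ n : ℕ, hilbertFn A M (maximalIdeal A) n ≤ hilbertFn A M (maximalIdeal A) (n + 1) := by
  obtain ⟨π, hπ⟩ := hquot
  obtain ⟨x₀, hx₀, y, hy, hsq₀⟩ := hminmult.exists_sq_maximalIdeal_eq_of_surjective π hπ
  obtain ⟨b, hb⟩ := Ideal.exists_add_mul_notMem_minimalPrimes (x := x₀) (y := y) <| by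
    intro P hP hx hy
    have hle : maximalIdeal A ^ 2 ≤ P := hsq₀ ▸ Ideal.mul_le_left.trans
      (Ideal.span_le.mpr (Set.pair_subset hx hy))
    have hPm : P = maximalIdeal A :=
      le_antisymm (le_maximalIdeal hP.1.1.ne_top) (hP.1.1.le_of_pow_le hle)
    exact maximalIdeal_notMem_minimalPrimes_of_ringKrullDim_eq_one hdimA (hPm ▸ hP)
  set x := x₀ + b * y with hxdef
  have hx : x ∈ maximalIdeal A := add_mem hx₀ (Ideal.mul_mem_left _ b hy)
  have hsq : maximalIdeal A ^ 2 = Ideal.span {x, y} * maximalIdeal A := by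
    rw [hsq₀, hxdef, Ideal.span_pair_add_mul_right]
  have := isArtinianRing_quotient_span_singleton_of_notMem_minimalPrimes hdimA hb
  have hreg : IsSMulRegular M x := isSMulRegular_of_notMem_minimalPrimes hdimA
    (exists_isSMulRegular_of_seqDepth_ne_zero (by simp [hMCM])) hb
  have hmap {r : A} (hr : r ∈ maximalIdeal A) (n : ℕ) :
      (maximalIdeal A ^ n • (⊤ : Submodule A M)).map (LinearMap.lsmul A M r) ≤
        maximalIdeal A ^ (n + 1) • ⊤ := by
    rintro _ ⟨z, hz, rfl⟩
    rw [pow_succ', mul_smul]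
    exact Submodule.smul_mem_smul hr hz
  have hanti (n : ℕ) : maximalIdeal A ^ (n + 1) • (⊤ : Submodule A M) ≤ maximalIdeal A ^ n • ⊤ :=
    Submodule.smul_mono_left (Ideal.pow_le_pow_right n.le_succ)
  intro n
  rw [hilbertFn, hilbertFn, moduleLength, moduleLength, ← Module.coe_length, ← Module.coe_length,
    WithBot.coe_le_coe]
  refine Submodule.length_quotient_le_of_eq_map_sup_map (f := LinearMap.lsmul A M x)
    (g := LinearMap.lsmul A M y) hreg ?_ (hanti n) (hanti (n + 1)) (hmap hx n) (hmap hy n) ?_ ?_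
  · exact LinearMap.ext fun z ↦ smul_comm x y z
  · rw [show n + 1 + 1 = 2 + n by ring, pow_add, hsq, mul_assoc, ← pow_succ', mul_smul,
      Ideal.span_insert, Submodule.sup_smul, Submodule.ideal_span_singleton_smul,
      Submodule.ideal_span_singleton_smul]
    rfl
  · refine Module.length_ne_top_of_smul_eq_zero x ?_
    rintro ⟨z⟩
    exact (Submodule.Quotient.mk_eq_zero _).mpr ⟨z, hanti n z.2, rfl⟩
end

section
/- Let (A,m) be a Cohen–Macaulay Noetherian local ring of dimension d ≥ 1 and let M be a finitely generated A-module. Then the function n ↦ length_A(Tor₁^A(M, A/m^{n+1})) agrees, for all sufficiently large n, with a polynomial in n of degree at most d − 1. -/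
open CategoryTheory IsLocalRing

/-- `length_A (Tor₁^A(M, A/𝔪^{n+1}))`. -/
noncomputable def torOneLength (A : Type) [CommRing A] [IsLocalRing A]
    (M : Type) [AddCommGroup M] [Module A M] (n : ℕ) : WithBot ℕ∞ :=
  moduleLength A (((Tor (ModuleCat A) 1).obj (ModuleCat.of A M)).obj
    (ModuleCat.of A (A ⧸ ((maximalIdeal A) ^ (n + 1)))))

section

open Polynomial Filter IsLocalRing

/-- A rational sequence that agrees with a polynomial for all large arguments. -/
def EventuallyPolynomial (f : ℕ → ℚ) : Prop :=
  ∃ p : ℚ[X], ∀ᶠ n : ℕ in atTop, f n = p.eval (n : ℚ)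

lemma Polynomial.exists_comp_X_add_one_sub_eq (p : ℚ[X]) :
    ∃ q : ℚ[X], ∀ n : ℕ, q.eval ((n : ℚ) + 1) - q.eval (n : ℚ) = p.eval (n : ℚ) := by
  induction p using Polynomial.induction_on' with
  | add p₁ p₂ h₁ h₂ =>
    obtain ⟨q₁, h₁⟩ := h₁
    obtain ⟨q₂, h₂⟩ := h₂
    refine ⟨q₁ + q₂, fun n => ?_⟩
    rw [eval_add, eval_add, eval_add, ← h₁, ← h₂]
    ring
  | monomial k a =>
    refine ⟨C (a / (k + 1)) * Polynomial.bernoulli (k + 1), fun n => ?_⟩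
    have h := Polynomial.bernoulli_eval_one_add (k + 1) (n : ℚ)
    have hk : (k : ℚ) + 1 ≠ 0 := by positivity
    rw [add_comm (n : ℚ) 1, eval_mul, eval_mul, h, eval_monomial]
    rw [Nat.add_sub_cancel]
    simp only [eval_C]
    push_cast
    field_simp
    ring

lemma EventuallyPolynomial.of_sub {f g : ℕ → ℚ} (hg : EventuallyPolynomial g)
    (h : ∀ n, f (n + 1) - f n = g n) : EventuallyPolynomial f := by
  obtain ⟨p, hp⟩ := hg
  obtain ⟨q, hq⟩ := p.exists_comp_X_add_one_sub_eq
  obtain ⟨N, hN⟩ := eventually_atTop.mp hp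
  refine ⟨q + C (f N - q.eval (N : ℚ)), eventually_atTop.mpr ⟨N, fun n hn => ?_⟩⟩
  induction n, hn using Nat.le_induction with
  | base => simp
  | succ n hn ih =>
    have h₁ := h n
    rw [hN n hn, ← hq n] at h₁
    simp only [eval_add, eval_C] at ih ⊢
    push_cast
    linarith

lemma EventuallyPolynomial.sub {f g : ℕ → ℚ} (hf : EventuallyPolynomial f)
    (hg : EventuallyPolynomial g) : EventuallyPolynomial (fun n => f n - g n) := by
  obtain ⟨p, hp⟩ := hf
  obtain ⟨q, hq⟩ := hg
  refine ⟨p - q, ?_⟩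
  filter_upwards [hp, hq] with n h₁ h₂
  rw [h₁, h₂, eval_sub]

lemma Polynomial.degree_le_degree_of_eventually_le {p r : ℚ[X]}
    (h₀ : ∀ᶠ n : ℕ in atTop, 0 ≤ p.eval (n : ℚ))
    (h : ∀ᶠ n : ℕ in atTop, p.eval (n : ℚ) ≤ r.eval (n : ℚ)) : p.degree ≤ r.degree := by
  by_contra! hlt
  have hp : p ≠ 0 := by
    rintro rfl
    simp at hlt
  have ht := (Polynomial.div_tendsto_atTop_zero_of_degree_lt r p hlt).comp
    (tendsto_natCast_atTop_atTop (R := ℚ))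
  have hne : ∀ᶠ n : ℕ in atTop, p.eval (n : ℚ) ≠ 0 :=
    (tendsto_natCast_atTop_atTop (R := ℚ)).eventually
      (Polynomial.eventually_atTop_not_isRoot p hp)
  have hlt1 := ht.eventually (gt_mem_nhds (zero_lt_one' ℚ))
  obtain ⟨n, h₁, h₂, h₃, h₄⟩ := (h₀.and (h.and (hne.and hlt1))).exists
  have hpos : 0 < p.eval (n : ℚ) := lt_of_le_of_ne h₁ h₃.symm
  simp only [Function.comp_apply] at h₄
  rw [div_lt_one hpos] at h₄
  linarith

lemma Polynomial.degree_sub_comp_X_sub_C_le {p : ℚ[X]} {d : ℕ} (hd : 1 ≤ d)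
    (hp : p.degree ≤ d) (c : ℚ) : (p - p.comp (X - C c)).degree ≤ (d - 1 : ℕ) := by
  by_cases h0 : p = 0
  · simp [h0]
  have hdeg : p.degree = (p.comp (X - C c)).degree := by
    have hc : p.comp (X - C c) ≠ 0 := by
      rw [Ne, comp_eq_zero_iff]
      rintro (h | ⟨-, h⟩)
      · exact h0 h
      · have := congrArg natDegree h
        simp at this
    rw [degree_eq_natDegree h0, degree_eq_natDegree hc, natDegree_comp, natDegree_X_sub_C, mul_one]
  have hlt := degree_sub_lt_left hdeg h0 (by rw [leadingCoeff_comp (by simp)]; simp)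
  refine degree_le_of_natDegree_le ?_
  by_cases hz : p - p.comp (X - C c) = 0
  · simp [hz]
  · have := (natDegree_lt_iff_degree_lt hz).mpr (hlt.trans_le hp)
    omega

lemma Module.length_add_length_ker {A V W : Type*} [CommRing A] [AddCommGroup V] [AddCommGroup W]
    [Module A V] [Module A W] (f : V →ₗ[A] W) :
    Module.length A W + Module.length A (LinearMap.ker f) =
      Module.length A (W ⧸ LinearMap.range f) + Module.length A V := by
  rw [Module.length_eq_add_of_exact (LinearMap.ker f).subtype f.rangeRestrict
      (Submodule.subtype_injective _) (LinearMap.surjective_rangeRestrict _)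
      (LinearMap.exact_iff.mpr (by simp)),
    Module.length_eq_add_of_exact (LinearMap.range f).subtype
      (LinearMap.range f).mkQ (Submodule.subtype_injective _) (Submodule.mkQ_surjective _)
      (LinearMap.exact_iff.mpr (by simp))]
  ring

/-- Families of submodules `L n ≤ G n` that are stable under the operators `x i`, i.e. the
homogeneous submodules of a graded module over a polynomial ring. -/
abbrev StableFamily {A : Type*} [CommRing A] {ι : Type*} {G : ℕ → Type*}
    [∀ n, AddCommGroup (G n)] [∀ n, Module A (G n)] (x : ι → ∀ n, G n →ₗ[A] G (n + 1)) :=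
  {L : ∀ n, Submodule A (G n) // ∀ i n, L n ≤ (L (n + 1)).comap (x i n)}

theorem eventuallyPolynomial_length_of_wellFoundedGT {A : Type*} [CommRing A] (s : ℕ) :
    ∀ (G : ℕ → Type*) [∀ n, AddCommGroup (G n)] [∀ n, Module A (G n)]
      (x : Fin s → ∀ n, G n →ₗ[A] G (n + 1))
      (_ : ∀ i j n (g : G n), x i (n + 1) (x j n g) = x j (n + 1) (x i n g))
      (_ : ∀ n, Module.length A (G n) ≠ ⊤) (_ : WellFoundedGT (StableFamily x)),
      EventuallyPolynomial (fun n => ((Module.length A (G n)).toNat : ℚ)) := by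
  induction s with
  | zero =>
    intro G _ _ x _ _ hx
    let L : ℕ →o StableFamily x :=
      { toFun := fun k => ⟨fun n => if n < k then ⊤ else ⊥, fun i => i.elim0⟩
        monotone' := fun k l hkl n => by
          dsimp only
          split_ifs <;> first | exact le_rfl | exact bot_le | omega }
    obtain ⟨N, hN⟩ := WellFoundedGT.monotone_chain_condition L
    refine ⟨0, eventually_atTop.mpr ⟨N, fun n hn => ?_⟩⟩
    have h := congrFun (congrArg Subtype.val (hN (n + 1) (by omega))) n
    have h : (⊥ : Submodule A (G n)) = ⊤ := by
      change (if n < N then ⊤ else ⊥) = if n < n + 1 then ⊤ else ⊥ at h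
      simpa [hn.not_gt] using h
    have : Subsingleton (G n) := Submodule.subsingleton_iff A |>.mp (subsingleton_of_bot_eq_top h)
    simp
  | succ s ih =>
    intro G _ _ x hcomm hfin hx
    let y : ∀ n, G n →ₗ[A] G (n + 1) := x (Fin.last s)
    let xK : Fin s → ∀ n, LinearMap.ker (y n) →ₗ[A] LinearMap.ker (y (n + 1)) := fun i n =>
      (x i.castSucc n).restrict fun g hg => by
        rw [LinearMap.mem_ker] at hg ⊢
        rw [hcomm, hg, map_zero]
    let xC : Fin s → ∀ n, (G (n + 1) ⧸ LinearMap.range (y n)) →ₗ[A]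
        (G (n + 1 + 1) ⧸ LinearMap.range (y (n + 1))) := fun i n =>
      Submodule.mapQ _ _ (x i.castSucc (n + 1)) (by
        rintro _ ⟨g, rfl⟩
        exact ⟨x i.castSucc n g, hcomm _ _ _ _⟩)
    have hK := ih (fun n => LinearMap.ker (y n)) xK
      (fun i j n g => Subtype.ext (hcomm _ _ _ _))
      (fun n => ne_top_of_le_ne_top (hfin n)
        (Module.length_le_of_injective _ (Submodule.subtype_injective _)))
      (by
        let Φ : StableFamily xK → StableFamily x := fun L =>
          ⟨fun n => (L.1 n).map (Submodule.subtype _), by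
            rintro i n _ ⟨g, hg, rfl⟩
            induction i using Fin.lastCases with
            | last =>
              have : x (Fin.last s) n g = 0 := g.2
              simp [this]
            | cast i => exact ⟨xK i n g, L.2 i n hg, rfl⟩⟩
        have hΦ : StrictMono Φ := Monotone.strictMono_of_injective
          (fun L L' h n => Submodule.map_mono (h n))
          (fun L L' h => Subtype.ext <| funext fun n =>
            Submodule.map_injective_of_injective (Submodule.subtype_injective _)
              (congrFun (congrArg Subtype.val h) n))
        exact hΦ.wellFoundedGT)
    have hC := ih (fun n => G (n + 1) ⧸ LinearMap.range (y n)) xC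
      (fun i j n g => by
        obtain ⟨g, rfl⟩ := Submodule.mkQ_surjective _ g
        exact congrArg (Submodule.mkQ _) (hcomm _ _ _ g))
      (fun n => ne_top_of_le_ne_top (hfin (n + 1))
        (Module.length_le_of_surjective _ (Submodule.mkQ_surjective _)))
      (by
        let Φ : StableFamily xC → StableFamily x := fun L =>
          ⟨fun n => match n with
            | 0 => ⊥
            | n + 1 => (L.1 n).comap (Submodule.mkQ _), by
            rintro i (_ | n) g hg
            · rw [(Submodule.mem_bot A).mp hg]
              exact zero_mem _
            · induction i using Fin.lastCases with
              | last =>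
                have : Submodule.mkQ (LinearMap.range (y (n + 1))) (x (Fin.last s) (n + 1) g) = 0 :=
                  (Submodule.Quotient.mk_eq_zero _).mpr ⟨g, rfl⟩
                change Submodule.mkQ _ _ ∈ L.1 (n + 1)
                rw [this]
                exact zero_mem _
              | cast i => exact L.2 i n hg⟩
        have hΦ : StrictMono Φ := Monotone.strictMono_of_injective
          (fun L L' h n => match n with
            | 0 => le_rfl
            | n + 1 => Submodule.comap_mono (h n))
          (fun L L' h => Subtype.ext <| funext fun n =>
            Submodule.comap_injective_of_surjective (Submodule.mkQ_surjective _)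
              (congrFun (congrArg Subtype.val h) (n + 1)))
        exact hΦ.wellFoundedGT)
    refine (hC.sub hK).of_sub fun n => ?_
    have h := Module.length_add_length_ker (y n)
    have hK : Module.length A (LinearMap.ker (y n)) ≠ ⊤ := ne_top_of_le_ne_top (hfin n)
      (Module.length_le_of_injective _ (Submodule.subtype_injective _))
    have hC : Module.length A (G (n + 1) ⧸ LinearMap.range (y n)) ≠ ⊤ :=
      ne_top_of_le_ne_top (hfin (n + 1))
        (Module.length_le_of_surjective _ (Submodule.mkQ_surjective _))
    have h' := congrArg (fun l : ℕ∞ => (l.toNat : ℚ)) h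
    simp only [ENat.toNat_add (hfin (n + 1)) hK, ENat.toNat_add hC (hfin n), Nat.cast_add] at h'
    linarith

lemma Module.length_quotient_eq_add_of_le {A N : Type*} [CommRing A] [AddCommGroup N]
    [Module A N] {P Q : Submodule A N} (h : Q ≤ P) :
    Module.length A (N ⧸ Q) =
      Module.length A (P ⧸ Q.submoduleOf P) + Module.length A (N ⧸ P) := by
  have hle : Q.submoduleOf P ≤ Q.comap P.subtype := le_rfl
  refine Module.length_eq_add_of_exact (Submodule.mapQ _ Q P.subtype hle) (Submodule.factor h) ?_
    (Submodule.factor_surjective h) ?_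
  · rw [← LinearMap.ker_eq_bot, eq_bot_iff]
    intro v hv
    obtain ⟨v, rfl⟩ := Submodule.mkQ_surjective _ v
    exact (Submodule.Quotient.mk_eq_zero _).mpr ((Submodule.Quotient.mk_eq_zero Q).mp hv)
  · intro v
    obtain ⟨v, rfl⟩ := Submodule.mkQ_surjective _ v
    refine ⟨fun hv => ⟨Submodule.mkQ _ ⟨v, (Submodule.Quotient.mk_eq_zero P).mp hv⟩, rfl⟩, ?_⟩
    rintro ⟨w, hw⟩
    obtain ⟨w, rfl⟩ := Submodule.mkQ_surjective _ w
    rw [← hw]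
    exact (Submodule.Quotient.mk_eq_zero P).mpr w.2

lemma Module.length_ne_top_of_maximalIdeal_smul_eq_zero {A V : Type*} [CommRing A] [IsLocalRing A]
    [AddCommGroup V] [Module A V] [Module.Finite A V]
    (h : ∀ a ∈ maximalIdeal A, ∀ v : V, a • v = 0) : Module.length A V ≠ ⊤ := by
  have hV : Module.IsTorsionBySet A V (maximalIdeal A) := fun v a => h a a.2 v
  let _ := hV.module
  have := hV.isScalarTower (S := A)
  have : Module.Finite (A ⧸ maximalIdeal A) V := Module.Finite.of_restrictScalars_finite A _ V
  let _ : Field (A ⧸ maximalIdeal A) := Ideal.Quotient.field _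
  rw [Module.length_eq_of_surjective (R := A ⧸ maximalIdeal A) Ideal.Quotient.mk_surjective]
  exact Module.length_ne_top

section HilbertSamuel

variable {A N : Type*} [CommRing A] [AddCommGroup N] [Module A N]

/-- The `n`-th graded piece `I ^ n N / I ^ (n + 1) N` of the associated graded module. -/
abbrev AdicGradedPiece (I : Ideal A) (N : Type*) [AddCommGroup N] [Module A N] (n : ℕ) :=
  (I ^ n • ⊤ : Submodule A N) ⧸
    (I ^ (n + 1) • ⊤ : Submodule A N).submoduleOf (I ^ n • ⊤ : Submodule A N)

lemma Ideal.smul_mem_pow_succ_smul_top {I : Ideal A} {a : A} (ha : a ∈ I) {n : ℕ} {v : N}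
    (hv : v ∈ (I ^ n • ⊤ : Submodule A N)) : a • v ∈ (I ^ (n + 1) • ⊤ : Submodule A N) := by
  rw [pow_succ', mul_smul]
  exact Submodule.smul_mem_smul ha hv

lemma Ideal.pow_succ_smul_top_le (I : Ideal A) (n : ℕ) :
    (I ^ (n + 1) • ⊤ : Submodule A N) ≤ I ^ n • ⊤ :=
  Submodule.smul_mono_left (Ideal.pow_le_pow_right n.le_succ)

/-- Multiplication by an element of `I` between consecutive graded pieces. -/
def AdicGradedPiece.mulLeft {I : Ideal A} (a : I) (n : ℕ) :
    AdicGradedPiece I N n →ₗ[A] AdicGradedPiece I N (n + 1) :=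
  Submodule.mapQ _ _
    ((LinearMap.lsmul A N a).restrict fun _ hv => Ideal.smul_mem_pow_succ_smul_top a.2 hv)
    fun _ hv => Ideal.smul_mem_pow_succ_smul_top a.2 hv

/-- The filtration on `N` induced by a homogeneous submodule of the associated graded module. -/
def StableFamily.filtration {I : Ideal A} {ι : Type*} {x : ι → I}
    (hx : Ideal.span (Set.range fun i => (x i : A)) = I)
    (L : StableFamily fun i => AdicGradedPiece.mulLeft (N := N) (x i)) : I.Filtration N where
  N n := ((L.1 n).comap (Submodule.mkQ _)).map (Submodule.subtype _)
  mono n := by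
    rintro _ ⟨v, -, rfl⟩
    refine ⟨⟨v, I.pow_succ_smul_top_le n v.2⟩, ?_, rfl⟩
    have : Submodule.mkQ ((I ^ (n + 1) • ⊤ : Submodule A N).submoduleOf (I ^ n • ⊤))
        ⟨v, I.pow_succ_smul_top_le n v.2⟩ = 0 := (Submodule.Quotient.mk_eq_zero _).mpr v.2
    change Submodule.mkQ _ _ ∈ L.1 n
    rw [this]
    exact zero_mem _
  smul_le n := by
    rw [Submodule.smul_le]
    rintro r hr _ ⟨v, hv, rfl⟩
    have hle : Ideal.span (Set.range fun i => (x i : A)) ≤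
        (((L.1 (n + 1)).comap (Submodule.mkQ _)).map (Submodule.subtype _)).comap
          (LinearMap.toSpanSingleton A N v) := by
      rw [Ideal.span, Submodule.span_le]
      rintro _ ⟨i, rfl⟩
      exact ⟨⟨(x i : A) • (v : N), Ideal.smul_mem_pow_succ_smul_top (x i).2 v.2⟩, L.2 i n hv, rfl⟩
    exact hle (hx.symm ▸ hr)

lemma StableFamily.le_of_filtration_le {I : Ideal A} {ι : Type*} {x : ι → I}
    (hx : Ideal.span (Set.range fun i => (x i : A)) = I)
    {L L' : StableFamily fun i => AdicGradedPiece.mulLeft (N := N) (x i)}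
    (h : L.filtration hx ≤ L'.filtration hx) : L ≤ L' := by
  intro n v hv
  obtain ⟨v, rfl⟩ := Submodule.mkQ_surjective _ v
  obtain ⟨w, hw, hvw⟩ := h n ⟨v, hv, rfl⟩
  obtain rfl : w = v := Subtype.ext hvw
  exact hw

lemma wellFoundedGT_stableFamily_adicGradedPiece [IsNoetherianRing A] [Module.Finite A N]
    {I : Ideal A} {ι : Type*} {x : ι → I}
    (hx : Ideal.span (Set.range fun i => (x i : A)) = I) :
    WellFoundedGT (StableFamily fun i => AdicGradedPiece.mulLeft (N := N) (x i)) := by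
  let F := I.stableFiltration (⊤ : Submodule A N)
  have hF : IsNoetherian (reesAlgebra I) F.submodule := isNoetherian_of_fg_of_noetherian _ <|
    (Ideal.Filtration.submodule_fg_iff_stable F fun i => IsNoetherian.noetherian _).mpr
      (I.stableFiltration_stable ⊤)
  let Φ : StableFamily (fun i => AdicGradedPiece.mulLeft (N := N) (x i)) ↪o
      Submodule (reesAlgebra I) F.submodule :=
    OrderEmbedding.ofMapLEIff
      (fun L => (L.filtration hx).submodule.comap F.submodule.subtype) fun L L' => by
        refine ⟨fun h => StableFamily.le_of_filtration_le hx fun n v hv => ?_, fun h f hf n =>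
          Submodule.map_mono (Submodule.comap_mono (h n)) (hf n)⟩
        have hmem : ∀ F' : I.Filtration N, v ∈ F'.N n → PolynomialModule.single A n v ∈
            F'.submodule := fun F' hv' k => by
          rw [PolynomialModule.coeff_single, Finsupp.single_apply]
          split_ifs with hk
          · exact hk ▸ hv'
          · exact zero_mem _
        have hvF : v ∈ F.N n := by
          obtain ⟨w, -, rfl⟩ := hv
          exact w.2
        have := h (x := ⟨PolynomialModule.single A n v, hmem F hvF⟩) (hmem _ hv) n
        simpa using this
  exact Φ.strictMono.wellFoundedGT

variable [IsNoetherianRing A] [IsLocalRing A] [Module.Finite A N]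

variable (N) in
lemma length_adicGradedPiece_maximalIdeal_ne_top (n : ℕ) :
    Module.length A (AdicGradedPiece (maximalIdeal A) N n) ≠ ⊤ := by
  refine Module.length_ne_top_of_maximalIdeal_smul_eq_zero fun a ha v => ?_
  obtain ⟨v, rfl⟩ := Submodule.mkQ_surjective _ v
  exact (Submodule.Quotient.mk_eq_zero _).mpr (Ideal.smul_mem_pow_succ_smul_top ha v.2)

variable (A N) in
lemma length_quotient_maximalIdeal_pow_ne_top (n : ℕ) :
    Module.length A (N ⧸ (maximalIdeal A ^ n • ⊤ : Submodule A N)) ≠ ⊤ := by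
  induction n with
  | zero =>
    have : Subsingleton (N ⧸ (maximalIdeal A ^ 0 • ⊤ : Submodule A N)) := by
      rw [Submodule.Quotient.subsingleton_iff]
      simp
    simp
  | succ n ih =>
    rw [Module.length_quotient_eq_add_of_le ((maximalIdeal A).pow_succ_smul_top_le n)]
    exact WithTop.add_ne_top.mpr ⟨length_adicGradedPiece_maximalIdeal_ne_top N n, ih⟩

variable (A N) in
theorem eventuallyPolynomial_length_quotient_maximalIdeal_pow :
    EventuallyPolynomial fun n =>
      ((Module.length A (N ⧸ (maximalIdeal A ^ n • ⊤ : Submodule A N))).toNat : ℚ) := by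
  obtain ⟨s, y, hy⟩ := Submodule.fg_iff_exists_fin_generating_family.mp
    (IsNoetherian.noetherian (maximalIdeal A))
  let x : Fin s → maximalIdeal A := fun i => ⟨y i, hy ▸ Submodule.subset_span ⟨i, rfl⟩⟩
  refine (eventuallyPolynomial_length_of_wellFoundedGT s
    (fun n => AdicGradedPiece (maximalIdeal A) N n) (fun i => AdicGradedPiece.mulLeft (x i))
    (fun i j n g => ?_) (length_adicGradedPiece_maximalIdeal_ne_top N)
    (wellFoundedGT_stableFamily_adicGradedPiece hy)).of_sub fun n => ?_
  · obtain ⟨g, rfl⟩ := Submodule.mkQ_surjective _ g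
    exact congrArg (Submodule.mkQ _) (Subtype.ext (smul_comm (x i : A) (x j : A) (g : N)))
  · rw [Module.length_quotient_eq_add_of_le ((maximalIdeal A).pow_succ_smul_top_le n),
      ENat.toNat_add (length_adicGradedPiece_maximalIdeal_ne_top N n)
        (length_quotient_maximalIdeal_pow_ne_top A N n)]
    push_cast
    ring

end HilbertSamuel

section Growth

variable {A N : Type*} [CommRing A] [AddCommGroup N] [Module A N]

variable (N) in
lemma Module.length_quotient_sup_span_singleton_pow_le (J : Ideal A) (a : A) (n : ℕ) :
    Module.length A (N ⧸ ((J ⊔ Ideal.span {a ^ n}) • ⊤ : Submodule A N)) ≤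
      n * Module.length A (N ⧸ ((J ⊔ Ideal.span {a}) • ⊤ : Submodule A N)) := by
  induction n with
  | zero =>
    have : Subsingleton (N ⧸ ((J ⊔ Ideal.span {a ^ 0}) • ⊤ : Submodule A N)) := by
      rw [Submodule.Quotient.subsingleton_iff]
      simp
    simp
  | succ n ih =>
    have hle : ((J ⊔ Ideal.span {a}) • ⊤ : Submodule A N) ≤
        ((J ⊔ Ideal.span {a ^ (n + 1)}) • ⊤ : Submodule A N).comap (LinearMap.lsmul A N (a ^ n)) := by
      rw [Submodule.sup_smul, sup_le_iff]
      refine ⟨(Submodule.smul_mono_left le_sup_left).trans fun v hv => Submodule.smul_mem _ _ hv,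
        Submodule.smul_le.mpr fun r hr v _ => ?_⟩
      obtain ⟨b, rfl⟩ := Ideal.mem_span_singleton'.mp hr
      rw [Submodule.mem_comap, LinearMap.lsmul_apply, smul_smul]
      refine Submodule.smul_mem_smul (Ideal.mem_sup_right
        (Ideal.mem_span_singleton'.mpr ⟨b, by ring⟩)) trivial
    let f := Submodule.mapQ _ _ (LinearMap.lsmul A N (a ^ n)) hle
    have hle' : ((J ⊔ Ideal.span {a ^ n}) • ⊤ : Submodule A N) ≤
        LinearMap.ker ((LinearMap.range f).mkQ ∘ₗ Submodule.mkQ _) := by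
      rw [Submodule.sup_smul, sup_le_iff]
      refine ⟨fun v hv => ?_, Submodule.smul_le.mpr fun r hr v _ => ?_⟩
      · replace hv : v ∈ ((J ⊔ Ideal.span {a ^ (n + 1)}) • ⊤ : Submodule A N) :=
          Submodule.smul_mono_left le_sup_left hv
        rw [LinearMap.mem_ker, LinearMap.comp_apply, Submodule.mkQ_apply _ v,
          (Submodule.Quotient.mk_eq_zero _).mpr hv, map_zero]
      · obtain ⟨b, rfl⟩ := Ideal.mem_span_singleton'.mp hr
        exact (Submodule.Quotient.mk_eq_zero _).mpr
          ⟨Submodule.mkQ _ (b • v), congrArg (Submodule.mkQ _) (by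
            rw [LinearMap.lsmul_apply, smul_smul, mul_comm])⟩
    have hsurj : Module.length A (_ ⧸ LinearMap.range f) ≤
        Module.length A (N ⧸ ((J ⊔ Ideal.span {a ^ n}) • ⊤ : Submodule A N)) :=
      Module.length_le_of_surjective (Submodule.liftQ _ _ hle') (by
        rw [← LinearMap.range_eq_top, Submodule.range_liftQ, LinearMap.range_eq_top]
        exact (Submodule.mkQ_surjective _).comp (Submodule.mkQ_surjective _))
    calc _ ≤ _ := le_self_add.trans (Module.length_add_length_ker f).le
      _ ≤ _ := add_le_add_left (hsurj.trans ih) _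
      _ = _ := by push_cast; ring

variable (N) in
lemma Module.length_quotient_sup_span_pow_le (s : Finset A) (n : ℕ) (J : Ideal A) :
    Module.length A (N ⧸ ((J ⊔ Ideal.span ((· ^ n) '' (s : Set A))) • ⊤ : Submodule A N)) ≤
      (n : ℕ∞) ^ s.card * Module.length A (N ⧸ ((J ⊔ Ideal.span s) • ⊤ : Submodule A N)) := by
  classical
  induction s using Finset.induction_on generalizing J with
  | empty => rw [Finset.coe_empty, Set.image_empty]; simp
  | insert a s ha ih =>
    rw [Finset.coe_insert, Set.image_insert_eq, Ideal.span_insert, ← sup_assoc,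
      Ideal.span_insert, sup_comm (Ideal.span {a}), ← sup_assoc, Finset.card_insert_of_notMem ha,
      pow_succ, mul_assoc]
    refine (ih _).trans (mul_le_mul_right ?_ _)
    rw [sup_assoc, sup_comm (Ideal.span _), ← sup_assoc]
    exact Module.length_quotient_sup_span_singleton_pow_le N _ a n

lemma IsLocalRing.exists_finset_card_le_pow_le_span [IsNoetherianRing A] [IsLocalRing A] {d : ℕ}
    (hd : ringKrullDim A = d) : ∃ (s : Finset A) (r : ℕ), s.card ≤ d ∧
      Ideal.span s ≤ maximalIdeal A ∧ maximalIdeal A ^ r ≤ Ideal.span (s : Set A) := by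
  have hht : (maximalIdeal A).height = d := by
    rw [← WithBot.coe_inj, maximalIdeal_height_eq_ringKrullDim, hd]
    rfl
  obtain ⟨J, hJ, hrank, hheight⟩ :=
    (maximalIdeal A).exists_spanRank_eq_and_height_eq Ideal.IsPrime.ne_top'
  have hfg : Submodule.FG J := IsNoetherian.noetherian J
  have hcard : J.spanFinrank = d := by
    rw [Submodule.FG.spanRank_eq_spanFinrank hfg, hht] at hrank
    exact_mod_cast hrank
  obtain ⟨s, hs, hspan⟩ := Submodule.FG.exists_span_finset_card_eq_spanFinrank hfg
  obtain ⟨r, hr⟩ := Ideal.exists_pow_le_of_le_radical_of_fg (I := maximalIdeal A) (J := J)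
    (by
      have hmin := Ideal.mem_minimalPrimes_of_height_le hJ hheight.ge
      rw [Ideal.radical_eq_sInf]
      refine le_sInf fun p ⟨hp, hpp⟩ => hmin.2 ⟨hpp, hp⟩ (le_maximalIdeal hpp.ne_top))
    (IsNoetherian.noetherian _)
  exact ⟨s, r, (hs.trans hcard).le, hspan.le.trans hJ, hr.trans hspan.ge⟩

lemma Module.length_quotient_le_of_le {P Q : Submodule A N} (h : P ≤ Q) :
    Module.length A (N ⧸ Q) ≤ Module.length A (N ⧸ P) :=
  Module.length_le_of_surjective (Submodule.factor h) (Submodule.factor_surjective h)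

variable (N) in
lemma exists_length_quotient_maximalIdeal_pow_le [IsNoetherianRing A] [IsLocalRing A]
    [Module.Finite A N] {d : ℕ} (hd : ringKrullDim A = d) :
    ∃ C : ℕ, ∀ n ≥ 1, (Module.length A (N ⧸ (maximalIdeal A ^ n • ⊤ : Submodule A N))).toNat ≤
      n ^ d * C := by
  obtain ⟨s, r, hcard, hs, hr⟩ := exists_finset_card_le_pow_le_span hd
  refine ⟨(Module.length A (N ⧸ (maximalIdeal A ^ r • ⊤ : Submodule A N))).toNat, fun n hn => ?_⟩
  have hspan : Ideal.span ((· ^ n) '' (s : Set A)) ≤ maximalIdeal A ^ n := by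
    rw [Ideal.span_le]
    rintro _ ⟨a, ha, rfl⟩
    exact Ideal.pow_mem_pow (hs (Ideal.subset_span ha)) n
  have h := Module.length_quotient_sup_span_pow_le N s n ⊥
  rw [bot_sup_eq, bot_sup_eq] at h
  replace h := (Module.length_quotient_le_of_le (Submodule.smul_mono_left hspan)).trans (h.trans
    (mul_le_mul_right (Module.length_quotient_le_of_le (Submodule.smul_mono_left hr)) _))
  rw [← ENat.natCast_toNat (length_quotient_maximalIdeal_pow_ne_top A N n),
    ← ENat.natCast_toNat (length_quotient_maximalIdeal_pow_ne_top A N r)] at h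
  norm_cast at h
  exact h.trans (Nat.mul_le_mul_right _ (Nat.pow_le_pow_right hn hcard))

variable (N) in
lemma exists_hilbertSamuelPolynomial [IsNoetherianRing A] [IsLocalRing A]
    [Module.Finite A N] {d : ℕ} (hd : ringKrullDim A = d) :
    ∃ p : ℚ[X], p.degree ≤ d ∧ ∀ᶠ n : ℕ in atTop,
      ((Module.length A (N ⧸ (maximalIdeal A ^ n • ⊤ : Submodule A N))).toNat : ℚ) =
        p.eval (n : ℚ) := by
  obtain ⟨p, hp⟩ := eventuallyPolynomial_length_quotient_maximalIdeal_pow A N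
  obtain ⟨C, hC⟩ := exists_length_quotient_maximalIdeal_pow_le N hd
  refine ⟨p, ?_, hp⟩
  refine (Polynomial.degree_le_degree_of_eventually_le (r := Polynomial.C (C : ℚ) * X ^ d) ?_ ?_).trans
    (degree_C_mul_X_pow_le _ _)
  · filter_upwards [hp] with n hn
    rw [← hn]
    positivity
  · filter_upwards [hp, eventually_ge_atTop 1] with n hn h1
    rw [← hn, eval_mul, eval_C, eval_pow, eval_X, mul_comm]
    exact_mod_cast hC n h1

end Growth

section Tor

open CategoryTheory MonoidalCategory

universe u

variable {A : Type u} [CommRing A]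

lemma Module.length_eq_of_iso {X Y : ModuleCat.{u} A} (e : X ≅ Y) :
    Module.length A X = Module.length A Y :=
  e.toLinearEquiv.length_eq

lemma HomologicalComplex.epi_homologyMap_of_epi {C ι : Type*} [Category C] [Abelian C]
    {c : ComplexShape ι} {K L : HomologicalComplex C c} (φ : K ⟶ L) [Epi φ] (i : ι)
    (hi : ¬ c.Rel i (c.next i)) : Epi (homologyMap φ i) := by
  have hK := K.isIso_homologyι i _ rfl (K.shape _ _ hi)
  have hL := L.isIso_homologyι i _ rfl (L.shape _ _ hi)
  have h := homologyι_naturality φ i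
  rw [← IsIso.eq_comp_inv] at h
  rw [h]
  infer_instance

lemma length_tor_one_add_length_tensorProduct (S : ShortComplex (ModuleCat.{u} A))
    (hS : S.ShortExact) [Module.Flat A S.X₂] (Y : ModuleCat.{u} A) :
    Module.length A (((Tor (ModuleCat.{u} A) 1).obj S.X₃).obj Y) +
        Module.length A (S.X₂ ⊗ Y : ModuleCat.{u} A) =
      Module.length A (S.X₁ ⊗ Y : ModuleCat.{u} A) +
        Module.length A (S.X₃ ⊗ Y : ModuleCat.{u} A) := by
  let P := projectiveResolution Y
  let G (X : ModuleCat.{u} A) :=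
    ((tensoringLeft (ModuleCat.{u} A)).obj X).mapHomologicalComplex (ComplexShape.down ℕ)
  let α {X X' : ModuleCat.{u} A} (f : X ⟶ X') : (G X).obj P.complex ⟶ (G X').obj P.complex :=
    (NatTrans.mapHomologicalComplex ((tensoringLeft (ModuleCat.{u} A)).map f) _).app P.complex
  let T : ShortComplex (ChainComplex (ModuleCat.{u} A) ℕ) :=
    ShortComplex.mk (α S.f) (α S.g) (by
      ext1 n
      change (S.f ▷ P.complex.X n) ≫ (S.g ▷ P.complex.X n) = 0
      rw [← comp_whiskerRight, S.zero, MonoidalPreadditive.zero_whiskerRight])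
  have hT : T.ShortExact := HomologicalComplex.shortExact_of_degreewise_shortExact _ fun n => by
    have : Module.Flat A (P.complex.X n) := by
      have := (IsProjective.iff_projective (P.complex.X n)).mpr (P.projective n)
      infer_instance
    exact hS.map_of_exact (tensorRight (P.complex.X n))
  have h₀ (X : ModuleCat.{u} A) : Module.length A (((G X).obj P.complex).homology 0) =
      Module.length A (X ⊗ Y : ModuleCat.{u} A) :=
    Module.length_eq_of_iso ((P.isoLeftDerivedObj ((tensoringLeft _).obj X) 0).symm ≪≫
      ((tensoringLeft (ModuleCat.{u} A)).obj X).leftDerivedZeroIsoSelf.app Y)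
  have h₁ : CategoryTheory.Limits.IsZero (T.X₂.homology 1) := by
    rw [← HomologicalComplex.exactAt_iff_isZero_homology]
    exact (P.complex_exactAt_succ 0).map (tensorLeft S.X₂)
  have hmono := hT.mono_δ 1 0 rfl h₁
  have hepi : Epi (HomologicalComplex.homologyMap T.g 0) :=
    have := hT.epi_g
    HomologicalComplex.epi_homologyMap_of_epi _ _ (by simp)
  have e₁ := (hT.homology_exact₁ 1 0 rfl).moduleCat_range_eq_ker
  have e₂ := (hT.homology_exact₂ 0).moduleCat_range_eq_ker
  have hφ := Module.length_add_length_ker (HomologicalComplex.homologyMap T.f 0).hom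
  have hδ : Module.length A (T.X₃.homology 1) =
      Module.length A (LinearMap.ker (HomologicalComplex.homologyMap T.f 0).hom) := by
    rw [← e₁]
    exact (LinearEquiv.ofInjective (hT.δ 1 0 rfl).hom
      ((ModuleCat.mono_iff_injective _).mp hmono)).length_eq
  have hψ : Module.length A (_ ⧸ LinearMap.range (HomologicalComplex.homologyMap T.f 0).hom) =
      Module.length A (T.X₃.homology 0) := by
    rw [e₂]
    exact (LinearMap.quotKerEquivOfSurjective (HomologicalComplex.homologyMap T.g 0).hom
      ((ModuleCat.epi_iff_surjective _).mp hepi)).length_eq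
  rw [hψ, ← hδ, h₀ S.X₁, h₀ S.X₂, h₀ S.X₃] at hφ
  rw [add_comm, add_comm (Module.length A (S.X₁ ⊗ Y : ModuleCat.{u} A)), ← hφ]
  exact congrArg _ (Module.length_eq_of_iso
    (P.isoLeftDerivedObj ((tensoringLeft _).obj S.X₃) 1))

lemma length_tor_one_quotient_add_length_quotient {F M : Type u} [AddCommGroup F] [Module A F]
    [AddCommGroup M] [Module A M] [Module.Flat A F] (f : F →ₗ[A] M) (hf : Function.Surjective f)
    (I : Ideal A) :
    Module.length A (((Tor (ModuleCat.{u} A) 1).obj (ModuleCat.of A M)).obj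
        (ModuleCat.of A (A ⧸ I))) + Module.length A (F ⧸ (I • ⊤ : Submodule A F)) =
      Module.length A (LinearMap.ker f ⧸ (I • ⊤ : Submodule A (LinearMap.ker f))) +
        Module.length A (M ⧸ (I • ⊤ : Submodule A M)) := by
  rw [← (TensorProduct.tensorQuotEquivQuotSMul F I).length_eq,
    ← (TensorProduct.tensorQuotEquivQuotSMul M I).length_eq,
    ← (TensorProduct.tensorQuotEquivQuotSMul (LinearMap.ker f) I).length_eq]
  have : Module.Flat A f.shortComplexKer.X₂ := ‹Module.Flat A F›
  exact length_tor_one_add_length_tensorProduct f.shortComplexKer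
    (LinearMap.shortExact_shortComplexKer hf) (ModuleCat.of A (A ⧸ I))

end Tor

section ArtinRees

variable {A F M : Type*} [CommRing A] [AddCommGroup F] [Module A F] [AddCommGroup M] [Module A M]

lemma Module.length_quotient_eq_length_quotient_ker_add (f : F →ₗ[A] M)
    (hf : Function.Surjective f) (Q : Submodule A F) :
    Module.length A (F ⧸ Q) =
      Module.length A (LinearMap.ker f ⧸ Q.comap (LinearMap.ker f).subtype) +
        Module.length A (M ⧸ Q.map f) := by
  refine Module.length_eq_add_of_exact
    (Submodule.mapQ (Q.comap (LinearMap.ker f).subtype) Q (LinearMap.ker f).subtype le_rfl)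
    (Submodule.mapQ Q (Q.map f) f (Submodule.le_comap_map f Q)) ?_ ?_ ?_
  · rw [← LinearMap.ker_eq_bot, Submodule.ker_mapQ, Submodule.mkQ_map_self]
  · rw [← LinearMap.range_eq_top, Submodule.range_mapQ, LinearMap.range_eq_top.mpr hf,
      Submodule.map_top, Submodule.range_mkQ]
  · rw [LinearMap.exact_iff, Submodule.ker_mapQ, Submodule.range_mapQ, Submodule.range_subtype,
      Submodule.comap_map_eq, Submodule.map_sup]
    simp

lemma exists_comap_subtype_pow_smul_top_le [IsNoetherianRing A] [Module.Finite A F] (I : Ideal A)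
    (K : Submodule A F) : ∃ c : ℕ, ∀ n ≥ c,
      (I ^ n • ⊤ : Submodule A F).comap K.subtype ≤ (I ^ (n - c) • ⊤ : Submodule A K) := by
  obtain ⟨c, hc⟩ := Ideal.exists_pow_inf_eq_pow_smul I K
  refine ⟨c, fun n hn => ?_⟩
  rw [← Submodule.map_le_map_iff_of_injective K.injective_subtype, Submodule.map_comap_subtype,
    inf_comm, hc n hn, Submodule.map_smul'', Submodule.map_subtype_top]
  exact Submodule.smul_mono le_rfl inf_le_right

lemma exists_length_quotient_ker_pow_add_le [IsNoetherianRing A] [Module.Finite A F] (f : F →ₗ[A] M)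
    (hf : Function.Surjective f) (I : Ideal A) : ∃ c : ℕ, ∀ n ≥ c,
      Module.length A (LinearMap.ker f ⧸ (I ^ (n - c) • ⊤ : Submodule A (LinearMap.ker f))) +
          Module.length A (M ⧸ (I ^ n • ⊤ : Submodule A M)) ≤
        Module.length A (F ⧸ (I ^ n • ⊤ : Submodule A F)) := by
  obtain ⟨c, hc⟩ := exists_comap_subtype_pow_smul_top_le I (LinearMap.ker f)
  refine ⟨c, fun n hn => ?_⟩
  rw [Module.length_quotient_eq_length_quotient_ker_add f hf, Submodule.map_smul'',
    Submodule.map_top, LinearMap.range_eq_top.mpr hf]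
  gcongr
  exact Module.length_quotient_le_of_le (hc n hn)

end ArtinRees

universe u

theorem exists_polynomial_length_tor_one (A : Type u) [CommRing A] [IsNoetherianRing A]
    [IsLocalRing A] {d : ℕ} (hd : 1 ≤ d) (hdim : ringKrullDim A = d)
    (M : Type u) [AddCommGroup M] [Module A M] [Module.Finite A M] :
    ∃ p : ℚ[X], p.degree ≤ (d - 1 : ℕ) ∧ ∀ᶠ n : ℕ in atTop, ∃ l : ℕ,
      Module.length A (((Tor (ModuleCat.{u} A) 1).obj (ModuleCat.of A M)).obj
        (ModuleCat.of A (A ⧸ maximalIdeal A ^ n))) = l ∧ (l : ℚ) = p.eval (n : ℚ) := by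
  obtain ⟨k, f, hf⟩ := Module.Finite.exists_fin' A M
  obtain ⟨pF, -, hpF⟩ := exists_hilbertSamuelPolynomial (Fin k → A) hdim
  obtain ⟨pK, hpKd, hpK⟩ := exists_hilbertSamuelPolynomial (LinearMap.ker f) hdim
  obtain ⟨pM, -, hpM⟩ := exists_hilbertSamuelPolynomial M hdim
  obtain ⟨c, hc⟩ := exists_length_quotient_ker_pow_add_le f hf (maximalIdeal A)
  have hl : ∀ n : ℕ, ∃ l : ℕ,
      Module.length A (((Tor (ModuleCat.{u} A) 1).obj (ModuleCat.of A M)).obj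
        (ModuleCat.of A (A ⧸ maximalIdeal A ^ n))) = l := fun n => by
    refine ENat.ne_top_iff_exists.mp (fun h => ?_) |>.imp fun _ => Eq.symm
    have h' := length_tor_one_quotient_add_length_quotient f hf (maximalIdeal A ^ n)
    rw [h, top_add] at h'
    exact WithTop.add_ne_top.mpr ⟨length_quotient_maximalIdeal_pow_ne_top A _ n,
      length_quotient_maximalIdeal_pow_ne_top A _ n⟩ h'.symm
  choose l hl using hl
  have hnat (N : Type u) [AddCommGroup N] [Module A N] [Module.Finite A N] (n : ℕ) :=
    (ENat.natCast_toNat (length_quotient_maximalIdeal_pow_ne_top A N n)).symm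
  have hpoly : ∀ᶠ n : ℕ in atTop, (l n : ℚ) = (pK + pM - pF).eval (n : ℚ) := by
    filter_upwards [hpF, hpK, hpM] with n hF hK hM
    rw [eval_sub, eval_add, ← hF, ← hK, ← hM, eq_sub_iff_add_eq]
    have h := length_tor_one_quotient_add_length_quotient f hf (maximalIdeal A ^ n)
    rw [hl, hnat (Fin k → A), hnat M, hnat (LinearMap.ker f)] at h
    exact_mod_cast h
  refine ⟨pK + pM - pF, (Polynomial.degree_le_degree_of_eventually_le ?_ ?_).trans
    (Polynomial.degree_sub_comp_X_sub_C_le hd hpKd c), hpoly.mono fun n hn => ⟨l n, hl n, hn⟩⟩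
  · filter_upwards [hpoly] with n hn
    rw [← hn]
    positivity
  · filter_upwards [hpF, hpM, (tendsto_sub_atTop_nat c).eventually hpK, eventually_ge_atTop c]
      with n hF hM hK hn
    have h := hc n hn
    rw [hnat (Fin k → A), hnat M, hnat (LinearMap.ker f)] at h
    norm_cast at h
    rw [Nat.cast_sub hn] at hK
    rw [eval_sub, eval_add, eval_sub, eval_comp, eval_sub, eval_X, eval_C, ← hF, ← hM, ← hK]
    have h' := (Nat.cast_le (α := ℚ)).mpr h
    rw [Nat.cast_add] at h'
    linarith

end

/-- Let `(A,𝔪)` be a Cohen–Macaulay Noetherian local ring of dimension `d ≥ 1` and `M` a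
finitely generated `A`-module.  Then `n ↦ length_A (Tor₁^A(M, A/𝔪^{n+1}))` is, for all large
`n`, given by a polynomial in `n` of degree at most `d - 1`. -/
theorem torOneLength_eventually_polynomial_of_degree_le
    (A : Type) [CommRing A] [IsNoetherianRing A] [IsLocalRing A]
    (d : ℕ) (hd : 1 ≤ d)
    (hdim : ringKrullDim A = d)
    (hdepth : seqDepth A A (maximalIdeal A) = d)
    (M : Type) [AddCommGroup M] [Module A M] [Module.Finite A M] :
    ∃ (p : Polynomial ℚ) (N : ℕ), p.degree ≤ (d - 1 : ℕ) ∧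
      ∀ n : ℕ, N ≤ n → ∃ ln : ℕ,
        torOneLength A M n = (ln : WithBot ℕ∞) ∧ (ln : ℚ) = p.eval (n : ℚ) := by
  obtain ⟨p, hp, h⟩ := exists_polynomial_length_tor_one A hd hdim M
  obtain ⟨N, hN⟩ := Filter.eventually_atTop.mp h
  refine ⟨Polynomial.taylor 1 p, N, (Polynomial.degree_taylor p 1).trans_le hp, fun n hn => ?_⟩
  obtain ⟨l, hl, hlp⟩ := hN (n + 1) (hn.trans n.le_succ)
  refine ⟨l, ?_, by rw [hlp, Polynomial.taylor_eval, Nat.cast_succ]⟩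
  rw [torOneLength, moduleLength, ← Module.coe_length, hl]
  rfl
end

section
/- Let K be a field and let A = K[[X,Y,Z]]/(Y³ − XZ, X⁵ − Z²), a one-dimensional Noetherian local ring with maximal ideal m generated by the images of X, Y, Z. Then the associated graded ring G(A) = ⊕_{n≥0} m^n/m^{n+1} is isomorphic, as a graded K-algebra, to K[X,Y,Z]/(XZ, Y⁶, Y³Z, Z²), where X, Y, Z have degree one. -/
set_option synthInstance.maxHeartbeats 2000000

open Polynomial

noncomputable section

variable (K : Type) [Field K]

/-- The ideal `(Y³ - XZ, X⁵ - Z²)` of `K[[X,Y,Z]]`. -/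
def powerIdeal : Ideal (MvPowerSeries (Fin 3) K) :=
  Ideal.span {MvPowerSeries.X 1 ^ 3 - MvPowerSeries.X 0 * MvPowerSeries.X 2,
    MvPowerSeries.X 0 ^ 5 - MvPowerSeries.X 2 ^ 2}

/-- The ring `A = K[[X,Y,Z]]/(Y³ - XZ, X⁵ - Z²)`. -/
abbrev ARing := MvPowerSeries (Fin 3) K ⧸ powerIdeal K

/-- The maximal ideal `𝔪` of `A`, generated by the images of `X`, `Y`, `Z`. -/
def mIdeal : Ideal (ARing K) :=
  Ideal.span {Ideal.Quotient.mk (powerIdeal K) (MvPowerSeries.X 0),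
    Ideal.Quotient.mk (powerIdeal K) (MvPowerSeries.X 1),
    Ideal.Quotient.mk (powerIdeal K) (MvPowerSeries.X 2)}

/-- The ideal `𝔪·R(𝔪)` of the Rees algebra `R(𝔪) = A[𝔪u]`. -/
def mRees : Ideal (reesAlgebra (mIdeal K)) :=
  Ideal.span ((algebraMap (ARing K) (reesAlgebra (mIdeal K))) '' ((mIdeal K) : Set (ARing K)))

/-- The associated graded ring `G(A) = R(𝔪)/𝔪R(𝔪) = ⊕_{n≥0} 𝔪^n/𝔪^{n+1}`,
realized as the quotient of the Rees algebra of `𝔪` by `𝔪·R(𝔪)`. -/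
abbrev GRing := reesAlgebra (mIdeal K) ⧸ mRees K

/-- The `n`-th graded piece `𝔪^n/𝔪^{n+1}` of `G(A)`: the image in `G(A)` of the degree-`n`
component `𝔪^n·uⁿ` of the Rees algebra. -/
def gPiece (n : ℕ) : Submodule K (GRing K) :=
  Submodule.span K {g : GRing K | ∃ a : ARing K, ∃ h : a ∈ (mIdeal K) ^ n,
    g = Ideal.Quotient.mk (mRees K)
      ⟨Polynomial.monomial n a, reesAlgebra.monomial_mem.mpr h⟩}

/-- The ideal `(XZ, Y⁶, Y³Z, Z²)` of the polynomial ring `K[X,Y,Z]`. -/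
def polyIdeal : Ideal (MvPolynomial (Fin 3) K) :=
  Ideal.span {MvPolynomial.X 0 * MvPolynomial.X 2, MvPolynomial.X 1 ^ 6,
    MvPolynomial.X 1 ^ 3 * MvPolynomial.X 2, MvPolynomial.X 2 ^ 2}

/-- The `n`-th graded piece of `K[X,Y,Z]/(XZ, Y⁶, Y³Z, Z²)`: the image of the homogeneous
polynomials of degree `n` (so `X`, `Y`, `Z` have degree one). -/
def pPiece (n : ℕ) : Submodule K (MvPolynomial (Fin 3) K ⧸ polyIdeal K) :=
  Submodule.map (Ideal.Quotient.mkₐ K (polyIdeal K)).toLinearMap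
    (MvPolynomial.homogeneousSubmodule (Fin 3) K n)

theorem coeff_mem_of_mem_span_algebraMap {R : Type*} [CommRing R] {I : Ideal R}
    {p : reesAlgebra I} (hp : p ∈ Ideal.span (algebraMap R (reesAlgebra I) '' (I : Set R)))
    (n : ℕ) : (p : R[X]).coeff n ∈ I ^ (n + 1) := by
  induction hp using Submodule.span_induction generalizing n with
  | mem x hx =>
    obtain ⟨a, ha, rfl⟩ := hx
    change (Polynomial.C a).coeff n ∈ _
    rw [Polynomial.coeff_C]
    split_ifs with h
    · subst h
      simpa using ha
    · exact Ideal.zero_mem _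
  | zero => simp
  | add x y _ _ hx hy => simpa using Ideal.add_mem _ (hx n) (hy n)
  | smul a x _ hx =>
    rw [smul_eq_mul, Subalgebra.coe_mul, Polynomial.coeff_mul]
    refine Ideal.sum_mem _ fun ij h => ?_
    rw [← Finset.HasAntidiagonal.mem_antidiagonal.mp h, add_assoc, pow_add]
    exact Ideal.mul_mem_mul (a.2 ij.1) (hx ij.2)

theorem monomial_mem_span_algebraMap {R : Type*} [CommRing R] {I : Ideal R} {n : ℕ} {a : R}
    (ha : a ∈ I ^ (n + 1)) (h : Polynomial.monomial n a ∈ reesAlgebra I) :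
    (⟨Polynomial.monomial n a, h⟩ : reesAlgebra I) ∈
      Ideal.span (algebraMap R (reesAlgebra I) '' (I : Set R)) := by
  rw [pow_succ'] at ha
  have key : ∃ h : Polynomial.monomial n a ∈ reesAlgebra I,
      (⟨Polynomial.monomial n a, h⟩ : reesAlgebra I) ∈
      Ideal.span (algebraMap R (reesAlgebra I) '' (I : Set R)) := by
    refine Submodule.mul_induction_on ha (fun r hr s hs => ?_) (fun x y hx hy => ?_)
    · have hs' : Polynomial.monomial n s ∈ reesAlgebra I := reesAlgebra.monomial_mem.mpr hs
      have e : Polynomial.monomial n (r * s) =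
          ((algebraMap R (reesAlgebra I) r * ⟨_, hs'⟩ : reesAlgebra I) : R[X]) := by
        change _ = Polynomial.C r * Polynomial.monomial n s
        rw [Polynomial.C_mul_monomial]
      refine ⟨e ▸ Subtype.prop _, ?_⟩
      simp only [e]
      exact Ideal.mul_mem_right _ _ (Ideal.subset_span ⟨r, hr, rfl⟩)
    · obtain ⟨hx, hx'⟩ := hx
      obtain ⟨hy, hy'⟩ := hy
      have e : Polynomial.monomial n (x + y) =
          ((⟨_, hx⟩ + ⟨_, hy⟩ : reesAlgebra I) : R[X]) := by simp
      refine ⟨e ▸ Subtype.prop _, ?_⟩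
      simp only [e]
      exact Ideal.add_mem _ hx' hy'
  exact key.2

theorem aeval_monomial_one_of_isHomogeneous {σ k R : Type*} [CommRing k] [CommRing R] [Algebra k R]
    (x : σ → R) {f : MvPolynomial σ k} {n : ℕ} (hf : f.IsHomogeneous n) :
    MvPolynomial.aeval (fun i => Polynomial.monomial 1 (x i)) f =
      Polynomial.monomial n (MvPolynomial.aeval x f) := by
  rw [MvPolynomial.aeval_def, MvPolynomial.aeval_def, MvPolynomial.eval₂_eq,
    MvPolynomial.eval₂_eq, map_sum]
  refine Finset.sum_congr rfl fun d hd => ?_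
  have hdeg : ∑ i ∈ d.support, d i = n := by
    change d.degree = n
    rw [Finsupp.degree_eq_weight_one]
    exact hf (MvPolynomial.mem_support_iff.mp hd)
  have hprod (s : Finset σ) : ∏ i ∈ s, (Polynomial.monomial 1 (x i) : R[X]) ^ d i =
      Polynomial.monomial (∑ i ∈ s, d i) (∏ i ∈ s, x i ^ d i) := by
    classical
    induction s using Finset.induction_on with
    | empty => simp
    | insert a s ha ih =>
      rw [Finset.prod_insert ha, Finset.prod_insert ha, Finset.sum_insert ha, ih,
        Polynomial.monomial_pow, Polynomial.monomial_mul_monomial, one_mul]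
  rw [hprod, hdeg, Polynomial.algebraMap_apply, Polynomial.C_mul_monomial]

theorem coeff_aeval_monomial_one {σ k R : Type*} [CommRing k] [CommRing R] [Algebra k R]
    (x : σ → R) (f : MvPolynomial σ k) (n : ℕ) :
    (MvPolynomial.aeval (fun i => (Polynomial.monomial 1 (x i) : R[X])) f).coeff n =
      MvPolynomial.aeval x (MvPolynomial.homogeneousComponent n f) := by
  conv_lhs => rw [← MvPolynomial.sum_homogeneousComponent f]
  rw [map_sum, Polynomial.finsetSum_coeff, Finset.sum_congr rfl fun i _ => by
    rw [aeval_monomial_one_of_isHomogeneous x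
      (MvPolynomial.homogeneousComponent_isHomogeneous i f), Polynomial.coeff_monomial]]
  rw [Finset.sum_ite_eq']
  split_ifs with h
  · rfl
  · rw [MvPolynomial.homogeneousComponent_eq_zero n f (by simpa using h), map_zero]

theorem MvPowerSeries.eq_sum_X_mul_of_constantCoeff_eq_zero {R : Type*} [CommRing R]
    {f : MvPowerSeries (Fin 3) R} (hf : MvPowerSeries.constantCoeff f = 0) :
    ∃ g : Fin 3 → MvPowerSeries (Fin 3) R, f = ∑ i, MvPowerSeries.X i * g i := by
  classical
  have h0 : (MvPowerSeries.X 0 : MvPowerSeries (Fin 3) R) ∣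
      fun m => if m 0 ≠ 0 then MvPowerSeries.coeff m f else 0 :=
    MvPowerSeries.X_dvd_iff.mpr fun m hm => if_neg (by simpa using hm)
  have h1 : (MvPowerSeries.X 1 : MvPowerSeries (Fin 3) R) ∣
      fun m => if m 0 = 0 ∧ m 1 ≠ 0 then MvPowerSeries.coeff m f else 0 :=
    MvPowerSeries.X_dvd_iff.mpr fun m hm => if_neg (by simp [hm])
  have h2 : (MvPowerSeries.X 2 : MvPowerSeries (Fin 3) R) ∣
      fun m => if m 0 = 0 ∧ m 1 = 0 then MvPowerSeries.coeff m f else 0 := by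
    refine MvPowerSeries.X_dvd_iff.mpr fun m hm => ite_eq_right_iff.mpr fun h => ?_
    have : m = 0 := by
      ext i
      fin_cases i
      exacts [h.1, h.2, hm]
    rw [this]
    exact hf
  obtain ⟨g0, h0⟩ := h0
  obtain ⟨g1, h1⟩ := h1
  obtain ⟨g2, h2⟩ := h2
  refine ⟨![g0, g1, g2], ?_⟩
  simp only [Fin.sum_univ_three, Matrix.cons_val]
  rw [← h0, ← h1, ← h2]
  funext m
  change f m = (if m 0 ≠ 0 then f m else 0) + (if m 0 = 0 ∧ m 1 ≠ 0 then f m else 0) +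
    (if m 0 = 0 ∧ m 1 = 0 then f m else 0)
  by_cases a : m 0 = 0 <;> by_cases b : m 1 = 0 <;> simp [a, b]

/-- The exponents `6a + 7b + 15c` with `a + b + c ≥ k`. -/
def weightSet (k : ℕ) : Set ℕ := {w | ∃ a b c : ℕ, k ≤ a + b + c ∧ w = 6 * a + 7 * b + 15 * c}

/-- The parametrization `(t⁶, t⁷, t¹⁵)`. -/
def curve : Fin 3 → PowerSeries K := ![PowerSeries.X ^ 6, PowerSeries.X ^ 7, PowerSeries.X ^ 15]

theorem hasSubst_curve : MvPowerSeries.HasSubst (curve K) := by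
  refine MvPowerSeries.hasSubst_of_constantCoeff_zero fun s => ?_
  change PowerSeries.constantCoeff _ = 0
  fin_cases s <;> simp [curve]

theorem prod_curve_pow (d : Fin 3 → ℕ) :
    ∏ i, curve K i ^ d i = PowerSeries.X ^ (6 * d 0 + 7 * d 1 + 15 * d 2) := by
  simp [Fin.prod_univ_three, curve, ← pow_mul, pow_add]

/-- The homomorphism `A → K[[t]]` given by `X ↦ t⁶`, `Y ↦ t⁷`, `Z ↦ t¹⁵`. -/
def toPowerSeries : ARing K →ₐ[K] PowerSeries K :=
  Ideal.Quotient.liftₐ (powerIdeal K) (MvPowerSeries.substAlgHom (hasSubst_curve K)) (by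
    intro a ha
    have : powerIdeal K ≤ RingHom.ker (MvPowerSeries.substAlgHom (R := K) (hasSubst_curve K)) := by
      rw [powerIdeal, Ideal.span_le]
      rintro _ (rfl | rfl) <;>
      simp only [SetLike.mem_coe, RingHom.mem_ker, map_sub, map_pow, map_mul,
        MvPowerSeries.substAlgHom_X] <;> simp [curve] <;> ring
    exact this ha)

/-- The images of `X`, `Y`, `Z` in `A`. -/
def aX (i : Fin 3) : ARing K := Ideal.Quotient.mk (powerIdeal K) (MvPowerSeries.X i)

theorem mIdeal_eq_span_range : mIdeal K = Ideal.span (Set.range (aX K)) := by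
  rw [mIdeal]
  congr 1
  ext a
  simp [Fin.exists_fin_succ, aX, eq_comm]

theorem toPowerSeries_aX (i : Fin 3) : toPowerSeries K (aX K i) = curve K i := by
  exact MvPowerSeries.substAlgHom_X (hasSubst_curve K) i

theorem add_mem_weightSet {j k v w : ℕ} (hv : v ∈ weightSet j) (hw : w ∈ weightSet k) :
    v + w ∈ weightSet (j + k) := by
  obtain ⟨a, b, c, h, rfl⟩ := hv
  obtain ⟨a', b', c', h', rfl⟩ := hw
  exact ⟨a + a', b + b', c + c', by omega, by ring⟩

/-- The power series all of whose exponents lie in `weightSet k`. -/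
def weightSubgroup (k : ℕ) : AddSubgroup (PowerSeries K) where
  carrier := {g | ∀ w, PowerSeries.coeff w g ≠ 0 → w ∈ weightSet k}
  zero_mem' w hw := by simp at hw
  add_mem' {f g} hf hg w hw := by
    by_cases h : PowerSeries.coeff w f = 0
    · exact hg w (by simpa [h] using hw)
    · exact hf w h
  neg_mem' {f} hf w hw := hf w (by simpa using hw)

variable {K} in
theorem mul_mem_weightSubgroup {j k : ℕ} {f g : PowerSeries K} (hf : f ∈ weightSubgroup K j)
    (hg : g ∈ weightSubgroup K k) : f * g ∈ weightSubgroup K (j + k) := by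
  intro w hw
  rw [PowerSeries.coeff_mul] at hw
  obtain ⟨p, hp, hne⟩ := Finset.exists_ne_zero_of_sum_ne_zero hw
  rw [← Finset.HasAntidiagonal.mem_antidiagonal.mp hp]
  exact add_mem_weightSet (hf _ (left_ne_zero_of_mul hne)) (hg _ (right_ne_zero_of_mul hne))

theorem curve_mem_weightSubgroup (i : Fin 3) : curve K i ∈ weightSubgroup K 1 := by
  intro w hw
  fin_cases i <;> simp [curve, PowerSeries.coeff_X_pow] at hw <;> subst hw
  exacts [⟨1, 0, 0, by simp⟩, ⟨0, 1, 0, by simp⟩, ⟨0, 0, 1, by simp⟩]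

theorem toPowerSeries_mem_weightSubgroup_zero (a : ARing K) :
    toPowerSeries K a ∈ weightSubgroup K 0 := by
  obtain ⟨f, rfl⟩ := Ideal.Quotient.mk_surjective a
  intro w hw
  change MvPowerSeries.coeff (Finsupp.single () w)
    (MvPowerSeries.substAlgHom (hasSubst_curve K) f) ≠ 0 at hw
  rw [MvPowerSeries.substAlgHom_apply, MvPowerSeries.coeff_subst (hasSubst_curve K)] at hw
  obtain ⟨d, hd⟩ := not_forall.mp (mt finsum_eq_zero_of_forall_eq_zero hw)
  have hd := right_ne_zero_of_smul hd
  rw [Finsupp.prod_fintype _ _ (by simp), prod_curve_pow] at hd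
  change PowerSeries.coeff w _ ≠ 0 at hd
  rw [PowerSeries.coeff_X_pow] at hd
  exact ⟨d 0, d 1, d 2, by simp, by simpa using hd⟩

theorem toPowerSeries_mem_weightSubgroup {k : ℕ} {a : ARing K} (ha : a ∈ mIdeal K ^ k) :
    toPowerSeries K a ∈ weightSubgroup K k := by
  induction k generalizing a with
  | zero => exact toPowerSeries_mem_weightSubgroup_zero K a
  | succ k ih =>
    have ha : a ∈ mIdeal K ^ k * mIdeal K := pow_succ (mIdeal K) k ▸ ha
    refine Submodule.mul_induction_on ha (fun r hr s hs => ?_) (fun x y hx hy => ?_)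
    · rw [map_mul]
      refine mul_mem_weightSubgroup (ih hr) ?_
      rw [mIdeal_eq_span_range] at hs
      induction hs using Submodule.span_induction with
      | mem x hx =>
        obtain ⟨i, rfl⟩ := hx
        rw [toPowerSeries_aX]
        exact curve_mem_weightSubgroup K i
      | zero => rw [map_zero]; exact zero_mem _
      | add x y _ _ hx hy => rw [map_add]; exact add_mem hx hy
      | smul a x _ hx =>
        rw [smul_eq_mul, map_mul, ← zero_add 1]
        exact mul_mem_weightSubgroup (toPowerSeries_mem_weightSubgroup_zero K a) hx
    · rw [map_add]
      exact add_mem hx hy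

theorem aX_mem (i : Fin 3) : aX K i ∈ mIdeal K := by
  rw [mIdeal_eq_span_range]
  exact Ideal.subset_span ⟨i, rfl⟩

/-- The `K`-algebra homomorphism `K[X,Y,Z] → R(𝔪)` sending the variables to `xu`, `yu`, `zu`. -/
def reesEval : MvPolynomial (Fin 3) K →ₐ[K] reesAlgebra (mIdeal K) :=
  MvPolynomial.aeval fun i => ⟨Polynomial.monomial 1 (aX K i),
    reesAlgebra.monomial_mem.mpr (by simpa using aX_mem K i)⟩

theorem coe_reesEval (f : MvPolynomial (Fin 3) K) :
    (reesEval K f : (ARing K)[X]) =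
      MvPolynomial.aeval (fun i => Polynomial.monomial 1 (aX K i)) f := by
  have h : (((reesAlgebra (mIdeal K)).val.restrictScalars K).comp (reesEval K)) =
      MvPolynomial.aeval (fun i => Polynomial.monomial 1 (aX K i)) := by
    ext i : 1
    simp [reesEval]
  exact DFunLike.congr_fun h f

/-- The `K`-algebra homomorphism `K[X,Y,Z] → G(A)` sending the variables to the initial forms of
`x`, `y`, `z`. -/
def gradedEval : MvPolynomial (Fin 3) K →ₐ[K] GRing K :=
  (Ideal.Quotient.mkₐ K (mRees K)).comp (reesEval K)

theorem aeval_aX_mem_pow {f : MvPolynomial (Fin 3) K} {n : ℕ} (hf : f.IsHomogeneous n) :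
    MvPolynomial.aeval (aX K) f ∈ mIdeal K ^ n := by
  have := (reesEval K f).2 n
  rwa [coe_reesEval, aeval_monomial_one_of_isHomogeneous _ hf, Polynomial.coeff_monomial_same]
    at this

theorem gradedEval_of_isHomogeneous {f : MvPolynomial (Fin 3) K} {n : ℕ}
    (hf : f.IsHomogeneous n) :
    gradedEval K f = Ideal.Quotient.mk (mRees K)
      ⟨Polynomial.monomial n (MvPolynomial.aeval (aX K) f),
        reesAlgebra.monomial_mem.mpr (aeval_aX_mem_pow K hf)⟩ := by
  change Ideal.Quotient.mk (mRees K) (reesEval K f) = _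
  congr 1
  exact Subtype.ext ((coe_reesEval K f).trans (aeval_monomial_one_of_isHomogeneous _ hf))

theorem gradedEval_eq_zero_of_isHomogeneous {f : MvPolynomial (Fin 3) K} {n : ℕ}
    (hf : f.IsHomogeneous n) (h : MvPolynomial.aeval (aX K) f ∈ mIdeal K ^ (n + 1)) :
    gradedEval K f = 0 := by
  rw [gradedEval_of_isHomogeneous K hf, Ideal.Quotient.eq_zero_iff_mem]
  exact monomial_mem_span_algebraMap h _

theorem aX_one_pow_three : aX K 1 ^ 3 = aX K 0 * aX K 2 := by
  refine Ideal.Quotient.eq.mpr (Ideal.subset_span ?_)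
  simp

theorem aX_two_sq : aX K 2 ^ 2 = aX K 0 ^ 5 := by
  refine (Ideal.Quotient.eq.mpr (Ideal.subset_span ?_)).symm
  simp

theorem polyIdeal_le_ker : polyIdeal K ≤ RingHom.ker (gradedEval K) := by
  have hX (i : Fin 3) := MvPolynomial.isHomogeneous_X K i
  have hpow (i : Fin 3) (n : ℕ) := Ideal.pow_mem_pow (aX_mem K i) n
  rw [polyIdeal, Ideal.span_le]
  rintro _ (rfl | rfl | rfl | rfl)
  · refine gradedEval_eq_zero_of_isHomogeneous K ((hX 0).mul (hX 2)) ?_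
    have := hpow 1 3
    rw [aX_one_pow_three] at this
    simpa using this
  · refine gradedEval_eq_zero_of_isHomogeneous K ((hX 1).pow 6) ?_
    have e : aX K 1 ^ 6 = aX K 0 ^ 7 := by
      linear_combination (aX K 1 ^ 3 + aX K 0 * aX K 2) * aX_one_pow_three K +
        aX K 0 ^ 2 * aX_two_sq K
    simpa [e] using hpow 0 7
  · refine gradedEval_eq_zero_of_isHomogeneous K (((hX 1).pow 3).mul (hX 2)) ?_
    have e : aX K 1 ^ 3 * aX K 2 = aX K 0 ^ 6 := by
      linear_combination aX K 2 * aX_one_pow_three K + aX K 0 * aX_two_sq K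
    simpa [e] using Ideal.pow_le_pow_right (by norm_num) (hpow 0 6)
  · refine gradedEval_eq_zero_of_isHomogeneous K ((hX 2).pow 2) ?_
    simpa [aX_two_sq] using Ideal.pow_le_pow_right (by norm_num) (hpow 0 5)

theorem coeff_toPowerSeries_aeval (f : MvPolynomial (Fin 3) K) (w : ℕ) :
    PowerSeries.coeff w (toPowerSeries K (MvPolynomial.aeval (aX K) f)) =
      ∑ d ∈ f.support, if w = 6 * d 0 + 7 * d 1 + 15 * d 2 then f.coeff d else 0 := by
  have h : (toPowerSeries K).comp (MvPolynomial.aeval (aX K)) = MvPolynomial.aeval (curve K) := by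
    ext i : 1
    simp [toPowerSeries_aX]
  rw [← AlgHom.comp_apply, h, MvPolynomial.aeval_def, MvPolynomial.eval₂_eq', map_sum]
  refine Finset.sum_congr rfl fun d _ => ?_
  rw [prod_curve_pow, ← Algebra.smul_def, PowerSeries.coeff_smul, PowerSeries.coeff_X_pow]
  simp

theorem mem_polyIdeal_iff (f : MvPolynomial (Fin 3) K) :
    f ∈ polyIdeal K ↔ ∀ d ∈ f.support, (1 ≤ d 0 ∧ 1 ≤ d 2) ∨ 6 ≤ d 1 ∨ (3 ≤ d 1 ∧ 1 ≤ d 2) ∨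
      2 ≤ d 2 := by
  have h : polyIdeal K = Ideal.span ((fun s => MvPolynomial.monomial s (1 : K)) ''
      {Finsupp.single 0 1 + Finsupp.single 2 1, Finsupp.single 1 6,
        Finsupp.single 1 3 + Finsupp.single 2 1, Finsupp.single 2 2}) := by
    simp [polyIdeal, Set.image_insert_eq, MvPolynomial.X, MvPolynomial.monomial_pow,
      MvPolynomial.monomial_mul]
  rw [h, MvPolynomial.mem_ideal_span_monomial_image]
  refine forall₂_congr fun d _ => ?_
  simp [Finsupp.le_def, Fin.forall_fin_succ]

theorem ker_gradedEval : RingHom.ker (gradedEval K) = polyIdeal K := by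
  refine le_antisymm (fun f hf => ?_) (polyIdeal_le_ker K)
  rw [mem_polyIdeal_iff]
  intro d hd
  by_contra hcon
  have hmem : reesEval K f ∈ mRees K := Ideal.Quotient.eq_zero_iff_mem.mp hf
  have hcoeff := coeff_mem_of_mem_span_algebraMap hmem d.degree
  rw [coe_reesEval, coeff_aeval_monomial_one] at hcoeff
  have hw := toPowerSeries_mem_weightSubgroup K hcoeff (6 * d 0 + 7 * d 1 + 15 * d 2)
  have hdeg (e : Fin 3 →₀ ℕ) : e.degree = e 0 + e 1 + e 2 := by
    rw [Finsupp.degree_eq_sum, Fin.sum_univ_three]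
  rw [coeff_toPowerSeries_aeval, Finset.sum_eq_single d] at hw
  · rw [if_pos rfl, MvPolynomial.coeff_homogeneousComponent, if_pos rfl] at hw
    obtain ⟨a, b, c, h, h'⟩ := hw (MvPolynomial.mem_support_iff.mp hd)
    rw [hdeg] at h
    omega
  · intro e he hne
    refine if_neg fun h => hne ?_
    have hed : e.degree = d.degree := by
      by_contra h
      rw [MvPolynomial.mem_support_iff, MvPolynomial.coeff_homogeneousComponent, if_neg h] at he
      exact he rfl
    rw [hdeg, hdeg] at hed
    ext i
    fin_cases i <;> simp only [Fin.zero_eta, Fin.mk_one, Fin.reduceFinMk] <;> omega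
  · intro h
    rw [if_pos rfl]
    exact MvPolynomial.notMem_support_iff.mp h

theorem exists_algebraMap_sub_mem (a : ARing K) : ∃ c : K, a - algebraMap K _ c ∈ mIdeal K := by
  obtain ⟨f, rfl⟩ := Ideal.Quotient.mk_surjective a
  refine ⟨MvPowerSeries.constantCoeff f, ?_⟩
  obtain ⟨g, hg⟩ := MvPowerSeries.eq_sum_X_mul_of_constantCoeff_eq_zero
    (f := f - MvPowerSeries.C (MvPowerSeries.constantCoeff f)) (by simp)
  change Ideal.Quotient.mk (powerIdeal K)
    (f - MvPowerSeries.C (MvPowerSeries.constantCoeff f)) ∈ _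
  rw [hg, map_sum]
  refine Ideal.sum_mem _ fun i _ => ?_
  rw [map_mul]
  exact Ideal.mul_mem_right _ _ (aX_mem K i)

theorem mk_algebraMap_mem_range (a : ARing K) :
    Ideal.Quotient.mk (mRees K) (algebraMap _ _ a) ∈ (gradedEval K).range := by
  obtain ⟨c, hc⟩ := exists_algebraMap_sub_mem K a
  have h : Ideal.Quotient.mk (mRees K) (algebraMap _ _ a) = algebraMap K (GRing K) c := by
    change _ = Ideal.Quotient.mk (mRees K) (algebraMap (ARing K) _ (algebraMap K _ c))
    rw [Ideal.Quotient.eq, ← map_sub]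
    exact Ideal.subset_span ⟨_, hc, rfl⟩
  rw [h]
  exact Subalgebra.algebraMap_mem _ _

theorem gradedEval_surjective : Function.Surjective (gradedEval K) := by
  let S : Subalgebra (ARing K) (reesAlgebra (mIdeal K)) :=
    { ((gradedEval K).range.toSubring.comap (Ideal.Quotient.mk (mRees K))) with
      algebraMap_mem' := mk_algebraMap_mem_range K }
  have hS : reesAlgebra (mIdeal K) ≤ S.map (reesAlgebra (mIdeal K)).val := by
    conv_lhs => rw [← adjoin_monomial_eq_reesAlgebra, mIdeal_eq_span_range, Ideal.span,
      Submodule.map_span, Algebra.adjoin_span]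
    refine Algebra.adjoin_le ?_
    rintro _ ⟨_, ⟨i, rfl⟩, rfl⟩
    refine ⟨reesEval K (MvPolynomial.X i), ⟨MvPolynomial.X i, rfl⟩, ?_⟩
    exact (coe_reesEval K _).trans (MvPolynomial.aeval_X _ i)
  intro g
  obtain ⟨p, rfl⟩ := Ideal.Quotient.mk_surjective g
  obtain ⟨q, hq, hqp⟩ := hS p.2
  rw [← Subtype.ext hqp]
  exact hq

/-- For `A = K[[X,Y,Z]]/(Y³-XZ, X⁵-Z²)` with maximal ideal `𝔪 = (X,Y,Z)`, the associated
graded ring `G(A) = ⊕_{n≥0} 𝔪^n/𝔪^{n+1}` is isomorphic as a graded `K`-algebra to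
`K[X,Y,Z]/(XZ, Y⁶, Y³Z, Z²)`, where `X`, `Y`, `Z` have degree one. -/
theorem assocGraded_iso_example :
    ∃ e : (MvPolynomial (Fin 3) K ⧸ polyIdeal K) ≃ₐ[K] GRing K,
      ∀ n : ℕ, Submodule.map e.toLinearMap (pPiece K n) = gPiece K n := by
  let e : (MvPolynomial (Fin 3) K ⧸ polyIdeal K) ≃ₐ[K] GRing K :=
    (Ideal.quotientEquivAlgOfEq K (ker_gradedEval K).symm).trans
      (Ideal.quotientKerAlgEquivOfSurjective (gradedEval_surjective K))
  refine ⟨e, fun n => le_antisymm ?_ ?_⟩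
  · rintro _ ⟨_, ⟨f, hf, rfl⟩, rfl⟩
    exact Submodule.subset_span ⟨_, aeval_aX_mem_pow K hf, gradedEval_of_isHomogeneous K hf⟩
  · rw [gPiece, Submodule.span_le]
    rintro _ ⟨a, ha, rfl⟩
    obtain ⟨f, hf⟩ := gradedEval_surjective K (Ideal.Quotient.mk (mRees K)
      ⟨Polynomial.monomial n a, reesAlgebra.monomial_mem.mpr ha⟩)
    have hhom := MvPolynomial.homogeneousComponent_isHomogeneous n f
    refine ⟨_, ⟨MvPolynomial.homogeneousComponent n f, hhom, rfl⟩, ?_⟩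
    refine (gradedEval_of_isHomogeneous K hhom).trans (Ideal.Quotient.eq.mpr ?_)
    have hmem := coeff_mem_of_mem_span_algebraMap (Ideal.Quotient.eq.mp hf) n
    rw [Subalgebra.coe_sub, Polynomial.coeff_sub, AlgHom.coe_toRingHom, coe_reesEval,
      coeff_aeval_monomial_one, Polynomial.coeff_monomial_same] at hmem
    have h : Polynomial.monomial n
        (MvPolynomial.aeval (aX K) (MvPolynomial.homogeneousComponent n f) - a) ∈
          reesAlgebra (mIdeal K) :=
      reesAlgebra.monomial_mem.mpr (Ideal.pow_le_pow_right n.le_succ hmem)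
    have h_sub : (⟨_, h⟩ : reesAlgebra (mIdeal K)) =
        ⟨_, reesAlgebra.monomial_mem.mpr (aeval_aX_mem_pow K hhom)⟩ -
          ⟨_, reesAlgebra.monomial_mem.mpr ha⟩ :=
      Subtype.ext (map_sub (Polynomial.monomial n) _ _)
    exact h_sub ▸ monomial_mem_span_algebraMap hmem h

end
end
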